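/- arXiv:2008.07502 — 3 statements merged into one kernel-verified Lean document; each statement's English description precedes it below -/
import Mathlib

section
/- Let μ ∈ L¹₊(ℝⁿ) ∩ L^∞(ℝⁿ) with n ≥ 2 and M₂[μ] < ∞, and let μ* be its symmetric decreasing rearrangement. Then M₂[μ] − M₂[μ*] ≥ (2n ωₙ^{2/n})^{−1} ‖μ‖₁^{−1+2/n} ‖μ‖_∞^{−2/n} ‖μ − μ*‖₁². -/
open MeasureTheory

theorem two_mul_le_one_add_rpow_sub_one_sub_rpow {p x : ℝ} (hp0 : 0 < p) (hp1 : p ≤ 1)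
    (hx0 : 0 ≤ x) (hx1 : x ≤ 1) : 2 * p * x ≤ (1 + x) ^ p - (1 - x) ^ p := by
  let g : ℝ → ℝ := fun y => (1 + y) ^ p - (1 - y) ^ p - 2 * p * y
  have hderiv : ∀ y ∈ Set.Ioo (0 : ℝ) 1,
      HasDerivAt g (p * (1 + y) ^ (p - 1) + p * (1 - y) ^ (p - 1) - 2 * p) y := by
    intro y hy
    have h1 : HasDerivAt (fun y : ℝ => (1 + y) ^ p) (1 * p * (1 + y) ^ (p - 1)) y :=
      ((hasDerivAt_id y).const_add 1).rpow_const (Or.inl (by simp only [id]; linarith [hy.1]))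
    have h2 : HasDerivAt (fun y : ℝ => (1 - y) ^ p) (-1 * p * (1 - y) ^ (p - 1)) y :=
      ((hasDerivAt_id y).const_sub 1).rpow_const (Or.inl (by simp only [id]; linarith [hy.2]))
    have h3 : HasDerivAt (fun y : ℝ => 2 * p * y) (2 * p) y := by
      simpa using (hasDerivAt_id y).const_mul (2 * p)
    exact ((h1.sub h2).sub h3).congr_deriv (by ring)
  have hmono : MonotoneOn g (Set.Icc 0 1) := by
    refine monotoneOn_of_deriv_nonneg (convex_Icc 0 1) ?_ ?_ ?_
    · refine Continuous.continuousOn (Continuous.sub (Continuous.sub ?_ ?_) (by fun_prop))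
      · exact (continuous_const.add continuous_id).rpow_const fun _ => Or.inr hp0.le
      · exact (continuous_const.sub continuous_id).rpow_const fun _ => Or.inr hp0.le
    · rw [interior_Icc]
      exact fun y hy => (hderiv y hy).differentiableAt.differentiableWithinAt
    · rw [interior_Icc]
      intro y hy
      have hy1 : 0 < 1 + y := by linarith [hy.1]
      have hy2 : 0 < 1 - y := by linarith [hy.2]
      rw [(hderiv y hy).deriv, Real.rpow_def_of_pos hy1, Real.rpow_def_of_pos hy2]
      have e1 := Real.add_one_le_exp (Real.log (1 + y) * (p - 1))
      have e2 := Real.add_one_le_exp (Real.log (1 - y) * (p - 1))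
      have l1 := Real.log_le_sub_one_of_pos hy1
      have l2 := Real.log_le_sub_one_of_pos hy2
      have : 0 ≤ (Real.log (1 + y) + Real.log (1 - y)) * (p - 1) :=
        mul_nonneg_of_nonpos_of_nonpos (by linarith) (by linarith)
      nlinarith
  have := hmono ⟨le_rfl, zero_le_one⟩ ⟨hx0, hx1⟩ hx0
  simp only [g, add_zero, sub_zero, Real.one_rpow, mul_zero, sub_self] at this
  linarith

theorem two_add_mul_sq_le_one_add_rpow_add_one_sub_rpow {p x : ℝ} (hp0 : 0 < p) (hp1 : p ≤ 1)
    (hx0 : 0 ≤ x) (hx1 : x ≤ 1) :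
    2 + p * (p + 1) * x ^ 2 ≤ (1 + x) ^ (p + 1) + (1 - x) ^ (p + 1) := by
  let g : ℝ → ℝ := fun y => (1 + y) ^ (p + 1) + (1 - y) ^ (p + 1) - p * (p + 1) * y ^ 2
  have hderiv : ∀ y : ℝ,
      HasDerivAt g ((p + 1) * ((1 + y) ^ p - (1 - y) ^ p - 2 * p * y)) y := by
    intro y
    have h1 : HasDerivAt (fun y : ℝ => (1 + y) ^ (p + 1)) (1 * (p + 1) * (1 + y) ^ (p + 1 - 1)) y :=
      ((hasDerivAt_id y).const_add 1).rpow_const (Or.inr (by linarith))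
    have h2 : HasDerivAt (fun y : ℝ => (1 - y) ^ (p + 1))
        (-1 * (p + 1) * (1 - y) ^ (p + 1 - 1)) y :=
      ((hasDerivAt_id y).const_sub 1).rpow_const (Or.inr (by linarith))
    have h3 : HasDerivAt (fun y : ℝ => p * (p + 1) * y ^ 2) (p * (p + 1) * (2 * y)) y := by
      simpa using (hasDerivAt_pow 2 y).const_mul (p * (p + 1))
    refine ((h1.add h2).sub h3).congr_deriv ?_
    rw [add_sub_cancel_right]
    ring
  have hmono : MonotoneOn g (Set.Icc 0 1) := by
    refine monotoneOn_of_deriv_nonneg (convex_Icc 0 1)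
      (fun y _ => (hderiv y).continuousAt.continuousWithinAt)
      (fun y _ => (hderiv y).differentiableAt.differentiableWithinAt) ?_
    rw [interior_Icc]
    intro y hy
    rw [(hderiv y).deriv]
    have := two_mul_le_one_add_rpow_sub_one_sub_rpow hp0 hp1 hy.1.le hy.2.le
    exact mul_nonneg (by linarith) (by linarith)
  have := hmono ⟨le_rfl, zero_le_one⟩ ⟨hx0, hx1⟩ hx0
  simp only [g, add_zero, sub_zero, Real.one_rpow] at this
  nlinarith

theorem mul_rpow_mul_sq_le_second_difference_rpow {p m a : ℝ} (hp0 : 0 < p) (hp1 : p ≤ 1)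
    (hm : 0 < m) (ha0 : 0 ≤ a) (ham : a ≤ m) :
    p * (p + 1) * m ^ (p - 1) * a ^ 2 ≤
      (m + a) ^ (p + 1) + (m - a) ^ (p + 1) - 2 * m ^ (p + 1) := by
  have key := two_add_mul_sq_le_one_add_rpow_add_one_sub_rpow hp0 hp1
    (div_nonneg ha0 hm.le) ((div_le_one hm).2 ham)
  have h1 : (m + a) ^ (p + 1) = m ^ (p + 1) * (1 + a / m) ^ (p + 1) := by
    rw [← Real.mul_rpow hm.le (by positivity), mul_add, mul_one, mul_div_cancel₀ _ hm.ne']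
  have h2 : (m - a) ^ (p + 1) = m ^ (p + 1) * (1 - a / m) ^ (p + 1) := by
    rw [← Real.mul_rpow hm.le (sub_nonneg.2 ((div_le_one hm).2 ham)), mul_sub, mul_one,
      mul_div_cancel₀ _ hm.ne']
  have h3 : m ^ (p + 1) = m ^ (p - 1) * m ^ 2 := by
    rw [← Real.rpow_natCast, ← Real.rpow_add hm]
    congr 1
    push_cast
    ring
  have h4 : p * (p + 1) * m ^ (p - 1) * a ^ 2 = m ^ (p + 1) * (p * (p + 1) * (a / m) ^ 2) := by
    rw [h3]
    field_simp
  rw [h1, h2, h4]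
  have := mul_le_mul_of_nonneg_left key (Real.rpow_nonneg hm.le (p + 1))
  nlinarith

theorem linearized_rpow_mul_sq_le {p m a b l : ℝ} (hp0 : 0 ≤ p) (hp1 : p ≤ 1)
    (hm : 0 < m) (hb : 0 < b) :
    2 * l * a - l ^ 2 * (p * b ^ (1 - p) + (1 - p) * b ^ (-p) * m) ≤ m ^ (p - 1) * a ^ 2 := by
  have hq : 0 < m ^ (1 - p) := Real.rpow_pos_of_pos hm _
  have hinv : m ^ (p - 1) = (m ^ (1 - p))⁻¹ := by
    rw [← Real.rpow_neg hm.le, neg_sub]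
  have h1 : 2 * l * a - l ^ 2 * m ^ (1 - p) ≤ m ^ (p - 1) * a ^ 2 := by
    have : m ^ (p - 1) * a ^ 2 - (2 * l * a - l ^ 2 * m ^ (1 - p)) =
        (m ^ (1 - p))⁻¹ * (a - l * m ^ (1 - p)) ^ 2 := by
      rw [hinv]
      field_simp
      ring
    have : 0 ≤ (m ^ (1 - p))⁻¹ * (a - l * m ^ (1 - p)) ^ 2 := by positivity
    linarith
  have h2 : m ^ (1 - p) ≤ p * b ^ (1 - p) + (1 - p) * b ^ (-p) * m := by
    have amgm := Real.geom_mean_le_arith_mean2_weighted hp0 (sub_nonneg.2 hp1) hb.le hm.le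
      (by ring)
    have hbp : b ^ (-p) * b ^ p = 1 := by rw [← Real.rpow_add hb, neg_add_cancel, Real.rpow_zero]
    have hbq : b ^ (1 - p) = b ^ (-p) * b := by
      nth_rewrite 3 [← Real.rpow_one b]
      rw [← Real.rpow_add hb]
      congr 1
      ring
    calc m ^ (1 - p) = b ^ (-p) * (b ^ p * m ^ (1 - p)) := by rw [← mul_assoc, hbp, one_mul]
      _ ≤ b ^ (-p) * (p * b + (1 - p) * m) := by gcongr
      _ = _ := by rw [hbq]; ring
  nlinarith [mul_le_mul_of_nonneg_left h2 (sq_nonneg l)]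

/-- The measure with density `‖x‖ ^ 2`. -/
noncomputable def secondMomentMeasure (n : ℕ) : Measure (EuclideanSpace ℝ (Fin n)) :=
  volume.withDensity fun x => ((‖x‖₊ ^ 2 : NNReal) : ENNReal)

theorem secondMomentMeasure_absolutelyContinuous (n : ℕ) : secondMomentMeasure n ≪ volume :=
  withDensity_absolutelyContinuous _ _

theorem integral_secondMomentMeasure {n : ℕ} (f : EuclideanSpace ℝ (Fin n) → ℝ) :
    ∫ x, f x ∂secondMomentMeasure n = ∫ x, f x * ‖x‖ ^ 2 := by
  rw [secondMomentMeasure, integral_withDensity_eq_integral_smul (by fun_prop)]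
  simp [NNReal.smul_def, mul_comm]

theorem integrable_secondMomentMeasure_iff {n : ℕ} {f : EuclideanSpace ℝ (Fin n) → ℝ} :
    Integrable f (secondMomentMeasure n) ↔ Integrable fun x => f x * ‖x‖ ^ 2 := by
  rw [secondMomentMeasure, integrable_withDensity_iff_integrable_smul (by fun_prop)]
  simp [NNReal.smul_def, mul_comm]

theorem secondMomentMeasure_ball_le {n : ℕ} {r : ℝ} (hr : 0 ≤ r)
    {s : Set (EuclideanSpace ℝ (Fin n))} (hs : MeasurableSet s)
    (hvol : volume s = volume (Metric.ball (0 : EuclideanSpace ℝ (Fin n)) r)) :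
    secondMomentMeasure n (Metric.ball 0 r) ≤ secondMomentMeasure n s := by
  set b := Metric.ball (0 : EuclideanSpace ℝ (Fin n)) r
  have hb : MeasurableSet b := measurableSet_ball
  have hfin : volume b ≠ ⊤ := measure_ball_lt_top.ne
  have hdiff : volume (b \ s) = volume (s \ b) :=
    measure_sdiff_symm hb.nullMeasurableSet hs.nullMeasurableSet hvol.symm
      (measure_ne_top_of_subset Set.inter_subset_left hfin)
  have h1 : secondMomentMeasure n (b \ s) ≤ (Real.toNNReal r ^ 2 : NNReal) * volume (b \ s) := by
    rw [secondMomentMeasure, withDensity_apply _ (hb.diff hs), ← setLIntegral_const]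
    refine setLIntegral_mono measurable_const fun x hx => ?_
    have : ‖x‖ < r := by simpa [b] using hx.1
    gcongr
    exact (Real.le_toNNReal_iff_coe_le hr).2 this.le
  have h2 : (Real.toNNReal r ^ 2 : NNReal) * volume (s \ b) ≤ secondMomentMeasure n (s \ b) := by
    rw [secondMomentMeasure, withDensity_apply _ (hs.diff hb), ← setLIntegral_const]
    refine setLIntegral_mono (by fun_prop) fun x hx => ?_
    have : r ≤ ‖x‖ := by simpa [b] using hx.2
    gcongr
    exact Real.toNNReal_le_iff_le_coe.2 this
  rw [← measure_inter_add_sdiff b hs, ← measure_inter_add_sdiff s hb, Set.inter_comm s b]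
  exact add_le_add_right (h1.trans (hdiff ▸ h2)) _

theorem secondMomentMeasure_real_ball {n : ℕ} (hn : 1 ≤ n) {r : ℝ} (hr : 0 ≤ r) :
    (secondMomentMeasure n).real (Metric.ball 0 r) =
      n * volume.real (Metric.ball (0 : EuclideanSpace ℝ (Fin n)) 1) * r ^ (n + 2) / (n + 2) := by
  have : Nontrivial (EuclideanSpace ℝ (Fin n)) := by
    have : Nonempty (Fin n) := ⟨⟨0, hn⟩⟩
    infer_instance
  have h := integral_fun_norm_addHaar (volume : Measure (EuclideanSpace ℝ (Fin n)))
    (fun y => (Set.Iio r).indicator 1 y * y ^ 2 : ℝ → ℝ)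
  have h2 : ∀ x : EuclideanSpace ℝ (Fin n), (Set.Iio r).indicator (1 : ℝ → ℝ) ‖x‖ =
      (Metric.ball (0 : EuclideanSpace ℝ (Fin n)) r).indicator 1 x := by
    intro x
    by_cases hx : ‖x‖ < r
    · rw [Set.indicator_of_mem (mem_ball_zero_iff.2 hx), Set.indicator_of_mem (Set.mem_Iio.2 hx)]
      rfl
    · rw [Set.indicator_of_notMem (mt mem_ball_zero_iff.1 hx),
        Set.indicator_of_notMem (mt Set.mem_Iio.1 hx)]
  simp_rw [h2] at h
  rw [← integral_secondMomentMeasure, integral_indicator_one measurableSet_ball] at h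
  rw [h]
  have h3 : ∫ y in Set.Ioi (0 : ℝ), y ^ (n - 1) • ((Set.Iio r).indicator 1 y * y ^ 2) =
      r ^ (n + 2) / (n + 2) := by
    have : ∀ y : ℝ, y ^ (n - 1) • ((Set.Iio r).indicator 1 y * y ^ 2) =
        (Set.Iio r).indicator (fun y => y ^ (n + 1)) y := by
      intro y
      by_cases hy : y ∈ Set.Iio r
      · simp [hy, ← pow_add]
        congr 1
        omega
      · simp [hy]
    simp_rw [this]
    rw [setIntegral_indicator measurableSet_Iio, Set.Ioi_inter_Iio, ← integral_Ioc_eq_integral_Ioo,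
      ← intervalIntegral.integral_of_le hr, integral_pow]
    push_cast
    simp
    ring
  simp only [finrank_euclideanSpace, Fintype.card_fin]
  rw [h3]
  simp
  ring

/-- The second moment of a centred ball of volume `v` in `ℝⁿ`. -/
noncomputable def ballSecondMoment (n : ℕ) (v : ℝ) : ℝ :=
  volume.real (Metric.ball (0 : EuclideanSpace ℝ (Fin n)) 1) ^ (-((2 : ℝ) / n)) *
    v ^ ((2 : ℝ) / n + 1) / ((2 : ℝ) / n + 1)

theorem exists_ball_volume_eq {n : ℕ} (hn : 1 ≤ n) {v : ℝ} (hv : 0 ≤ v) :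
    ∃ r : ℝ, 0 ≤ r ∧ volume (Metric.ball (0 : EuclideanSpace ℝ (Fin n)) r) = ENNReal.ofReal v ∧
      (secondMomentMeasure n).real (Metric.ball 0 r) = ballSecondMoment n v := by
  have : Nontrivial (EuclideanSpace ℝ (Fin n)) := by
    have : Nonempty (Fin n) := ⟨⟨0, hn⟩⟩
    infer_instance
  set w := volume.real (Metric.ball (0 : EuclideanSpace ℝ (Fin n)) 1) with hw
  have hw0 : 0 < w := ENNReal.toReal_pos (Metric.measure_ball_pos _ _ one_pos).ne' measure_ball_lt_top.ne
  have hn0 : (n : ℝ) ≠ 0 := by positivity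
  have hpow : ((v / w) ^ ((1 : ℝ) / n)) ^ n = v / w := by
    rw [← Real.rpow_natCast, ← Real.rpow_mul (by positivity), one_div_mul_cancel hn0,
      Real.rpow_one]
  refine ⟨(v / w) ^ ((1 : ℝ) / n), by positivity, ?_, ?_⟩
  · rw [Measure.addHaar_ball _ _ (by positivity), finrank_euclideanSpace, Fintype.card_fin, hpow,
      ← ofReal_measureReal measure_ball_lt_top.ne, ← ENNReal.ofReal_mul (by positivity)]
    rw [← hw, div_mul_cancel₀ _ hw0.ne']
  · rw [secondMomentMeasure_real_ball hn (by positivity), ← hw, pow_add, hpow, ballSecondMoment,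
      ← hw, ← Real.rpow_natCast _ 2, ← Real.rpow_mul (by positivity), Real.div_rpow hv hw0.le,
      Real.rpow_neg hw0.le, Real.rpow_add_one' hv (by positivity)]
    have : (1 : ℝ) / n * (2 : ℕ) = 2 / n := by push_cast; ring
    rw [this]
    field_simp
    ring

theorem ballSecondMoment_le {n : ℕ} (hn : 1 ≤ n) {s : Set (EuclideanSpace ℝ (Fin n))}
    (hs : MeasurableSet s) (hvol : volume s ≠ ⊤) (hfin : secondMomentMeasure n s ≠ ⊤) :
    ballSecondMoment n (volume.real s) ≤ (secondMomentMeasure n).real s := by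
  obtain ⟨r, hr, h1, h2⟩ := exists_ball_volume_eq hn (measureReal_nonneg (μ := volume) (s := s))
  rw [ofReal_measureReal hvol] at h1
  rw [← h2]
  exact ENNReal.toReal_mono hfin (secondMomentMeasure_ball_le hr hs h1.symm)

theorem exists_ball_ae_eq_of_norm_lower {n : ℕ} (hn : 1 ≤ n)
    {b : Set (EuclideanSpace ℝ (Fin n))} (hb : MeasurableSet b) (hvol : volume b ≠ ⊤)
    (hlower : ∀ x y : EuclideanSpace ℝ (Fin n), ‖x‖ ≤ ‖y‖ → y ∈ b → x ∈ b) :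
    ∃ r : ℝ, 0 ≤ r ∧ b =ᵐ[volume] Metric.ball (0 : EuclideanSpace ℝ (Fin n)) r ∧
      (secondMomentMeasure n).real b = ballSecondMoment n (volume.real b) := by
  obtain ⟨r, hr, h1, h2⟩ := exists_ball_volume_eq hn (measureReal_nonneg (μ := volume) (s := b))
  rw [ofReal_measureReal hvol] at h1
  have hae : b =ᵐ[volume] Metric.ball (0 : EuclideanSpace ℝ (Fin n)) r := by
    by_cases h : b ⊆ Metric.ball 0 r
    · exact ae_eq_of_subset_of_measure_ge h h1.le hb.nullMeasurableSet measure_ball_lt_top.ne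
    · obtain ⟨y, hyb, hyr⟩ := Set.not_subset.1 h
      refine (ae_eq_of_subset_of_measure_ge (fun x hx => ?_) h1.ge
        measurableSet_ball.nullMeasurableSet hvol).symm
      simp only [mem_ball_zero_iff, not_lt] at hx hyr
      exact hlower x y (hx.le.trans hyr) hyb
  refine ⟨r, hr, hae, ?_⟩
  rw [← h2]
  exact measureReal_congr ((secondMomentMeasure_absolutelyContinuous n).ae_eq hae)

theorem secondMomentMeasure_le_of_norm_lower {n : ℕ} (hn : 1 ≤ n)
    {s b : Set (EuclideanSpace ℝ (Fin n))} (hs : MeasurableSet s) (hb : MeasurableSet b)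
    (hvol : volume b ≠ ⊤) (heq : volume b = volume s)
    (hlower : ∀ x y : EuclideanSpace ℝ (Fin n), ‖x‖ ≤ ‖y‖ → y ∈ b → x ∈ b) :
    secondMomentMeasure n b ≤ secondMomentMeasure n s := by
  obtain ⟨r, hr, hae, -⟩ := exists_ball_ae_eq_of_norm_lower hn hb hvol hlower
  rw [measure_congr ((secondMomentMeasure_absolutelyContinuous n).ae_eq hae)]
  exact secondMomentMeasure_ball_le hr hs (heq ▸ measure_congr hae)

theorem integrableOn_measureReal_superlevel {α : Type*} [MeasurableSpace α] {ρ : Measure α}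
    {f : α → ℝ} (hf : Integrable f ρ) (hf0 : 0 ≤ᵐ[ρ] f) :
    IntegrableOn (fun t => ρ.real {x | t < f x}) (Set.Ioi 0) := by
  have hanti : Antitone fun t => ρ {x | t < f x} :=
    fun s t hst => measure_mono fun x hx => lt_of_le_of_lt hst hx
  refine integrable_toReal_of_lintegral_ne_top hanti.measurable.aemeasurable ?_
  rw [← lintegral_eq_lintegral_meas_lt ρ hf0 hf.aemeasurable]
  exact hf.lintegral_lt_top.ne

theorem integrable_of_measure_superlevel_le {α : Type*} [MeasurableSpace α] {ρ : Measure α}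
    {f g : α → ℝ} (hf : Integrable f ρ) (hf0 : 0 ≤ᵐ[ρ] f) (hg : AEStronglyMeasurable g ρ)
    (hg0 : 0 ≤ᵐ[ρ] g) (hle : ∀ t : ℝ, 0 < t → ρ {x | t < g x} ≤ ρ {x | t < f x}) :
    Integrable g ρ := by
  refine ⟨hg, ?_⟩
  rw [hasFiniteIntegral_iff_ofReal hg0, lintegral_eq_lintegral_meas_lt ρ hg0 hg.aemeasurable]
  refine (setLIntegral_mono' measurableSet_Ioi fun t ht => hle t ht).trans_lt ?_
  rw [← lintegral_eq_lintegral_meas_lt ρ hf0 hf.aemeasurable]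
  exact hf.lintegral_lt_top

theorem secondMomentMeasure_deficit_ge {n : ℕ} (hn : 2 ≤ n)
    {s b : Set (EuclideanSpace ℝ (Fin n))} (hs : MeasurableSet s) (hb : MeasurableSet b)
    (hvol : volume s ≠ ⊤) (heq : volume b = volume s) (hpos : 0 < volume.real s)
    (hlower : ∀ x y : EuclideanSpace ℝ (Fin n), ‖x‖ ≤ ‖y‖ → y ∈ b → x ∈ b)
    (hfin : secondMomentMeasure n s ≠ ⊤) :
    (2 : ℝ) / n * volume.real (Metric.ball (0 : EuclideanSpace ℝ (Fin n)) 1) ^ (-((2 : ℝ) / n)) *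
        (volume.real s ^ ((2 : ℝ) / n - 1) * (volume.real s - volume.real (s ∩ b)) ^ 2) ≤
      (secondMomentMeasure n).real s - (secondMomentMeasure n).real b := by
  have hn1 : 1 ≤ n := by omega
  have hn2 : (2 : ℝ) ≤ n := by exact_mod_cast hn
  have hvolb : volume b ≠ ⊤ := heq ▸ hvol
  have hfinb : secondMomentMeasure n b ≠ ⊤ :=
    ne_top_of_le_ne_top hfin (secondMomentMeasure_le_of_norm_lower hn1 hs hb hvolb heq hlower)
  obtain ⟨-, -, -, hB⟩ := exists_ball_ae_eq_of_norm_lower hn1 hb hvolb hlower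
  have heqr : volume.real b = volume.real s := congrArg ENNReal.toReal heq
  have hle : volume.real (s ∩ b) ≤ volume.real s := measureReal_mono Set.inter_subset_left hvol
  have hU := ballSecondMoment_le hn1 (hs.union hb) (measure_union_ne_top hvol hvolb)
    (measure_union_ne_top hfin hfinb)
  have hI := ballSecondMoment_le hn1 (hs.inter hb)
    (measure_ne_top_of_subset Set.inter_subset_left hvol)
    (measure_ne_top_of_subset Set.inter_subset_left hfin)
  have hsum := measureReal_union_add_inter (μ := secondMomentMeasure n) (s := s) hb hfin hfinb
  have hvsum := measureReal_union_add_inter (μ := volume) (s := s) hb hvol hvolb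
  have key := mul_rpow_mul_sq_le_second_difference_rpow (p := 2 / n) (by positivity)
    ((div_le_one (by positivity)).2 hn2) hpos (sub_nonneg.2 hle)
    (sub_le_self _ measureReal_nonneg)
  have e1 : volume.real s + (volume.real s - volume.real (s ∩ b)) = volume.real (s ∪ b) := by
    linarith
  rw [e1, sub_sub_cancel] at key
  rw [heqr] at hB
  set w := volume.real (Metric.ball (0 : EuclideanSpace ℝ (Fin n)) 1) with hw
  set p : ℝ := 2 / n with hp
  have hp0 : 0 < p := by positivity
  simp only [ballSecondMoment, ← hw, ← hp] at hU hI hB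
  have hc : 0 ≤ w ^ (-p) / (p + 1) := by positivity
  have := mul_le_mul_of_nonneg_left key hc
  calc _ = w ^ (-p) / (p + 1) * (p * (p + 1) * volume.real s ^ (p - 1) *
        (volume.real s - volume.real (s ∩ b)) ^ 2) := by field_simp
    _ ≤ _ := this
    _ = w ^ (-p) * volume.real (s ∪ b) ^ (p + 1) / (p + 1) +
        w ^ (-p) * volume.real (s ∩ b) ^ (p + 1) / (p + 1) -
        2 * (w ^ (-p) * volume.real s ^ (p + 1) / (p + 1)) := by ring
    _ ≤ _ := by linarith

/-- Stability of the second moment for general densities, `n ≥ 2`: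
`M₂[μ] − M₂[μ*] ≥ (2n ωₙ^{2/n})⁻¹ ‖μ‖₁^{−1+2/n} ‖μ‖_∞^{−2/n} ‖μ − μ*‖₁²`.
Here `ν` plays the role of the symmetric decreasing rearrangement `μ*`: it is
nonnegative, radially decreasing, and equimeasurable with `μ`. -/
theorem second_moment_stability {n : ℕ} (hn : 2 ≤ n)
    (μ ν : EuclideanSpace ℝ (Fin n) → ℝ)
    (hμmeas : Measurable μ) (hμ0 : ∀ x, 0 ≤ μ x) (hμint : Integrable μ)
    (hμbdd : eLpNorm μ ⊤ volume < ⊤)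
    (hM2 : Integrable (fun x => μ x * ‖x‖ ^ 2))
    (hν0 : ∀ x, 0 ≤ ν x) (hνmeas : Measurable ν)
    (hνrad : ∀ x y : EuclideanSpace ℝ (Fin n), ‖x‖ ≤ ‖y‖ → ν y ≤ ν x)
    (hequi : ∀ h : ℝ, 0 < h → volume {x | h < ν x} = volume {x | h < μ x}) :
    (∫ x, μ x * ‖x‖ ^ 2) - ∫ x, ν x * ‖x‖ ^ 2 ≥
      (2 * n * ((volume (Metric.ball (0 : EuclideanSpace ℝ (Fin n)) 1)).toReal)
          ^ ((2 : ℝ) / n))⁻¹ *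
        (∫ x, μ x) ^ (-1 + (2 : ℝ) / n) *
        ((eLpNorm μ ⊤ volume).toReal) ^ (-((2 : ℝ) / n)) *
        (∫ x, |μ x - ν x|) ^ 2 := by
  have hn2 : (2 : ℝ) ≤ n := by exact_mod_cast hn
  have hμs : ∀ h : ℝ, MeasurableSet {x | h < μ x} := fun h =>
    measurableSet_lt measurable_const hμmeas
  have hνs : ∀ h : ℝ, MeasurableSet {x | h < ν x} := fun h =>
    measurableSet_lt measurable_const hνmeas
  have hlow : ∀ h : ℝ, ∀ x y : EuclideanSpace ℝ (Fin n), ‖x‖ ≤ ‖y‖ →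
      y ∈ {x | h < ν x} → x ∈ {x | h < ν x} := fun h x y hxy hy => lt_of_lt_of_le hy (hνrad x y hxy)
  have hvolμ : ∀ h : ℝ, 0 < h → volume {x | h < μ x} ≠ ⊤ := fun h hh =>
    (hμint.measure_gt_lt_top hh).ne
  have hμρ : Integrable μ (secondMomentMeasure n) := integrable_secondMomentMeasure_iff.2 hM2
  have hρle : ∀ h : ℝ, 0 < h →
      secondMomentMeasure n {x | h < ν x} ≤ secondMomentMeasure n {x | h < μ x} := fun h hh =>
    secondMomentMeasure_le_of_norm_lower (by omega) (hμs h) (hνs h)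
      (hequi h hh ▸ hvolμ h hh) (hequi h hh) (hlow h)
  have hνρ : Integrable ν (secondMomentMeasure n) :=
    integrable_of_measure_superlevel_le hμρ (ae_of_all _ hμ0) hνmeas.aestronglyMeasurable
      (ae_of_all _ hν0) hρle
  have hνint : Integrable ν :=
    integrable_of_measure_superlevel_le hμint (ae_of_all _ hμ0) hνmeas.aestronglyMeasurable
      (ae_of_all _ hν0) fun h hh => (hequi h hh).le
  have hmin : Integrable (fun x => min (μ x) (ν x)) := hμint.inf hνint
  have hmin0 : ∀ x, 0 ≤ min (μ x) (ν x) := fun x => le_min (hμ0 x) (hν0 x)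
  have hminset : ∀ h : ℝ, {x | h < min (μ x) (ν x)} = {x | h < μ x} ∩ {x | h < ν x} := by
    intro h
    ext x
    simp
  have Lμ := hμint.integral_eq_integral_meas_lt (ae_of_all _ hμ0)
  have Lν := hνint.integral_eq_integral_meas_lt (ae_of_all _ hν0)
  have Lmin := hmin.integral_eq_integral_meas_lt (ae_of_all _ hmin0)
  have Lμρ := hμρ.integral_eq_integral_meas_lt (ae_of_all _ hμ0)
  have Lνρ := hνρ.integral_eq_integral_meas_lt (ae_of_all _ hν0)
  have Iμ := integrableOn_measureReal_superlevel hμint (ae_of_all _ hμ0)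
  have Imin := integrableOn_measureReal_superlevel hmin (ae_of_all _ hmin0)
  have Iμρ := integrableOn_measureReal_superlevel hμρ (ae_of_all _ hμ0)
  have Iνρ := integrableOn_measureReal_superlevel hνρ (ae_of_all _ hν0)
  rw [integral_secondMomentMeasure] at Lμρ Lνρ
  have hmass : ∫ x, ν x = ∫ x, μ x := by
    rw [Lμ, Lν]
    exact setIntegral_congr_fun measurableSet_Ioi fun h hh => congrArg ENNReal.toReal (hequi h hh)
  have habs : ∫ x, |μ x - ν x| = 2 * ((∫ x, μ x) - ∫ x, min (μ x) (ν x)) := by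
    have : ∀ x, |μ x - ν x| = μ x + ν x - 2 * min (μ x) (ν x) := fun x => by
      have := min_add_max (μ x) (ν x)
      have := max_sub_min_eq_abs' (μ x) (ν x)
      linarith
    have hadd : Integrable fun x => μ x + ν x := hμint.add hνint
    simp_rw [this]
    rw [integral_sub hadd (hmin.const_mul 2), integral_add hμint hνint, hmass,
      integral_const_mul]
    ring
  have hmin_nonneg : 0 ≤ ∫ x, min (μ x) (ν x) := integral_nonneg hmin0
  have hA0 : ∫ x, min (μ x) (ν x) ≤ ∫ x, μ x := integral_mono hmin hμint fun x => min_le_left _ _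
  rw [habs]
  change _ ≥ (2 * n * volume.real (Metric.ball (0 : EuclideanSpace ℝ (Fin n)) 1) ^ _)⁻¹ * _ * _ * _
  set w := volume.real (Metric.ball (0 : EuclideanSpace ℝ (Fin n)) 1)
  set p : ℝ := 2 / n with hp
  have hp0 : 0 < p := by positivity
  have hp1 : p ≤ 1 := (div_le_one (by positivity)).2 hn2
  set m := ∫ x, μ x
  set A := m - ∫ x, min (μ x) (ν x) with hA
  set M := (eLpNorm μ ⊤ volume).toReal
  have hm0 : 0 ≤ m := integral_nonneg hμ0
  rcases hm0.eq_or_lt with hm | hm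
  · have : A = 0 := by linarith
    rw [this, Lμρ, Lνρ]
    simp only [mul_zero, ne_eq, OfNat.ofNat_ne_zero, not_false_eq_true, zero_pow, ge_iff_le,
      sub_nonneg]
    exact setIntegral_mono_on Iνρ Iμρ measurableSet_Ioi fun h hh =>
      ENNReal.toReal_mono (hμρ.measure_gt_lt_top hh).ne (hρle h hh)
  have hμM : ∀ᵐ x, μ x ≤ M := by
    filter_upwards [ae_le_eLpNormEssSup (f := μ) (μ := volume)] with x hx
    rw [← eLpNorm_exponent_top] at hx
    have := ENNReal.toReal_mono hμbdd.ne hx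
    rw [toReal_enorm, Real.norm_of_nonneg (hμ0 x)] at this
    exact this
  have hM0 : 0 < M := by
    by_contra! h
    have : m ≤ 0 := integral_nonpos_of_ae (hμM.mono fun x hx => hx.trans h)
    linarith
  have hw0 : 0 < w :=
    ENNReal.toReal_pos (Metric.measure_ball_pos _ _ one_pos).ne' measure_ball_lt_top.ne
  set b := m / M
  have hb : 0 < b := div_pos hm hM0
  set c := p * w ^ (-p)
  have hc : 0 ≤ c := by positivity
  have key : ∀ l : ℝ, c * (2 * l * A - l ^ 2 * (M * b ^ (1 - p))) ≤
      (∫ x, μ x * ‖x‖ ^ 2) - ∫ x, ν x * ‖x‖ ^ 2 := by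
    intro l
    set k := l ^ 2 * (p * b ^ (1 - p))
    set q := l ^ 2 * ((1 - p) * b ^ (-p))
    have hk : 0 ≤ k := by positivity
    have hpt : ∀ h ∈ Set.Ioi (0 : ℝ),
        c * (2 * l * (volume.real {x | h < μ x} - volume.real {x | h < min (μ x) (ν x)}) -
          k * (Set.Iio M).indicator 1 h - q * volume.real {x | h < μ x}) ≤
        (secondMomentMeasure n).real {x | h < μ x} -
          (secondMomentMeasure n).real {x | h < ν x} := by
      intro h hh
      have hρfin := (hμρ.measure_gt_lt_top hh).ne
      rcases (measureReal_nonneg (μ := volume) (s := {x | h < μ x})).eq_or_lt with h0 | hpos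
      · have h1 : volume.real {x | h < min (μ x) (ν x)} = 0 := by
          refine le_antisymm ?_ measureReal_nonneg
          rw [h0, hminset]
          exact measureReal_mono Set.inter_subset_left (hvolμ h hh)
        have h2 : 0 ≤ (secondMomentMeasure n).real {x | h < μ x} -
            (secondMomentMeasure n).real {x | h < ν x} :=
          sub_nonneg.2 (ENNReal.toReal_mono hρfin (hρle h hh))
        have h3 : 0 ≤ (Set.Iio M).indicator (1 : ℝ → ℝ) h :=
          Set.indicator_nonneg (fun _ _ => zero_le_one) _
        rw [h1, ← h0]
        have := mul_nonneg hc (mul_nonneg hk h3)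
        linarith
      · have hhM : h ∈ Set.Iio M := by
          by_contra hle
          have : volume {x | h < μ x} = 0 := by
            refine measure_mono_null (fun x hx => ?_) (ae_iff.1 hμM)
            exact not_le.2 ((not_lt.1 hle).trans_lt hx)
          simp [measureReal_def, this] at hpos
        rw [Set.indicator_of_mem hhM, hminset, Pi.one_apply]
        refine le_trans ?_ (secondMomentMeasure_deficit_ge hn (hμs h) (hνs h) (hvolμ h hh)
          (hequi h hh) hpos (hlow h) hρfin)
        refine mul_le_mul_of_nonneg_left (le_trans (le_of_eq ?_)
          (linearized_rpow_mul_sq_le (l := l) hp0.le hp1 hpos hb)) hc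
        ring
    have hind : IntegrableOn ((Set.Iio M).indicator (1 : ℝ → ℝ)) (Set.Ioi 0) := by
      rw [IntegrableOn, integrable_indicator_iff measurableSet_Iio, IntegrableOn,
        Measure.restrict_restrict measurableSet_Iio, Set.Iio_inter_Ioi]
      exact integrableOn_const measure_Ioo_lt_top.ne
    have hindint : ∫ h in Set.Ioi (0 : ℝ), (Set.Iio M).indicator (1 : ℝ → ℝ) h = M := by
      rw [setIntegral_indicator measurableSet_Iio, Set.Ioi_inter_Iio]
      simp [hM0.le]
    have I1 : IntegrableOn (fun h => volume.real {x | h < μ x} -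
        volume.real {x | h < min (μ x) (ν x)}) (Set.Ioi 0) := Iμ.sub Imin
    have I2 : IntegrableOn (fun h => 2 * l * (volume.real {x | h < μ x} -
        volume.real {x | h < min (μ x) (ν x)}) - k * (Set.Iio M).indicator 1 h) (Set.Ioi 0) :=
      (I1.const_mul (2 * l)).sub (hind.const_mul k)
    have hint := setIntegral_mono_on ((I2.sub (Iμ.const_mul q)).const_mul c) (Iμρ.sub Iνρ)
      measurableSet_Ioi hpt
    simp only [Pi.sub_apply] at hint
    rw [integral_sub Iμρ Iνρ, integral_const_mul, integral_sub I2 (Iμ.const_mul q),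
      integral_sub (I1.const_mul (2 * l)) (hind.const_mul k),
      integral_const_mul, integral_const_mul, integral_const_mul, integral_sub Iμ Imin,
      hindint, ← Lμ, ← Lmin, ← Lμρ, ← Lνρ] at hint
    refine le_trans (le_of_eq ?_) hint
    have e1 : b ^ (-p) * m = M * b ^ (1 - p) := by
      have : m = M * b := (mul_div_cancel₀ m hM0.ne').symm
      rw [this, sub_eq_neg_add, Real.rpow_add_one hb.ne']
      ring
    have e2 : q * m = l ^ 2 * ((1 - p) * (M * b ^ (1 - p))) := by
      rw [← e1]
      ring
    rw [e2]
    ring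
  have hD : 0 < M * b ^ (1 - p) := by positivity
  have hfinal := key (A / (M * b ^ (1 - p)))
  refine ge_iff_le.2 (le_trans (le_of_eq ?_) hfinal)
  have e3 : (M * b ^ (1 - p))⁻¹ = m ^ (-1 + p) * M ^ (-p) := by
    rw [mul_inv, ← Real.rpow_neg hb.le, neg_sub, Real.div_rpow hm.le hM0.le, ← sub_eq_neg_add,
      Real.rpow_sub_one hM0.ne', Real.rpow_neg hM0.le]
    field_simp
  have e4 : c * (2 * (A / (M * b ^ (1 - p))) * A - (A / (M * b ^ (1 - p))) ^ 2 *
      (M * b ^ (1 - p))) = c * A ^ 2 * (M * b ^ (1 - p))⁻¹ := by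
    field_simp
    ring
  rw [e4, e3]
  simp only [c, Real.rpow_neg hw0.le]
  have hn0 : (n : ℝ) ≠ 0 := by positivity
  have hfac : p * (w ^ p)⁻¹ = 4 * (2 * n * w ^ p)⁻¹ := by
    rw [mul_inv, ← mul_assoc]
    congr 1
    rw [hp]
    field_simp
    norm_num
  rw [hfac]
  ring
end

section
/- Let D ⊂ ℝⁿ be a measurable set with finite measure and M₂[1_D] < ∞, and let D* be the centered ball of the same volume. Let T : ℝⁿ → ℝⁿ be any measure-preserving map pushing 1_{D*} forward to 1_D that minimizes ∫_{D*} |T(x) − x|² dx among all such maps. Then M₂[1_D] − M₂[1_{D*}] ≥ ∫_{D*} |T(x) − x|² dx. -/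
open MeasureTheory

section Convexity

open scoped RealInnerProductSpace NNReal
open Filter Topology

variable {E : Type*} [NormedAddCommGroup E] [InnerProductSpace ℝ E]

/-- The graph of `W` over `X` is cyclically monotone. -/
def CyclicallyMonotoneOn (W : E → E) (X : Set E) : Prop :=
  ∀ (c : ℕ → E), (∀ i, c i ∈ X) → ∀ k : ℕ,
    ∑ i ∈ Finset.range k, ⟪c i, W (c (i + 1)) - W (c i)⟫ + ⟪c k, W (c 0) - W (c k)⟫ ≤ 0

/-- Rockafellar's theorem: a cyclically monotone graph with bounded domain lies in the graph of the
inverse subdifferential of a Lipschitz convex function. -/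
theorem CyclicallyMonotoneOn.exists_convex_potential {W : E → E} {X : Set E}
    (hW : CyclicallyMonotoneOn W X) (hne : X.Nonempty) {r : ℝ≥0} (hX : ∀ x ∈ X, ‖x‖ ≤ r) :
    ∃ v : E → ℝ, ConvexOn ℝ Set.univ v ∧ LipschitzWith r v ∧
      ∀ x ∈ X, ∀ z, v (W x) + ⟪x, z - W x⟫ ≤ v z := by
  obtain ⟨x₀, hx₀⟩ := hne
  let ι := {p : (ℕ → X) × ℕ // p.1 0 = ⟨x₀, hx₀⟩}
  have : Nonempty ι := ⟨⟨(fun _ => ⟨x₀, hx₀⟩, 0), rfl⟩⟩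
  let b : ι → E := fun p => p.1.1 p.1.2
  let a : ι → E → ℝ := fun p z =>
    ∑ i ∈ Finset.range p.1.2, ⟪(p.1.1 i : E), W (p.1.1 (i + 1)) - W (p.1.1 i)⟫ +
      ⟪b p, z - W (b p)⟫
  have hdiff : ∀ p z z', a p z = a p z' + ⟪b p, z - z'⟫ := by
    intro p z z'
    simp only [a, inner_sub_right]; ring
  have hb : ∀ p, ‖b p‖ ≤ r := fun p => hX _ (p.1.1 p.1.2).2
  have hlip : ∀ p z z', a p z ≤ a p z' + r * ‖z - z'‖ := by
    intro p z z'
    rw [hdiff p z z']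
    have := real_inner_le_norm (b p) (z - z')
    have := mul_le_mul_of_nonneg_right (hb p) (norm_nonneg (z - z'))
    linarith
  have h0 : ∀ p, a p (W x₀) ≤ 0 := by
    intro p
    have := hW (fun i => p.1.1 i) (fun i => (p.1.1 i).2) p.1.2
    simp only [p.2] at this
    exact this
  have hbdd : ∀ z, BddAbove (Set.range fun p => a p z) := by
    intro z
    refine ⟨r * ‖z - W x₀‖, ?_⟩
    rintro _ ⟨p, rfl⟩
    have := hlip p z (W x₀)
    have := h0 p
    simp only
    linarith
  refine ⟨fun z => ⨆ p, a p z, ⟨convex_univ, ?_⟩, ?_, ?_⟩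
  · intro z _ z' _ s t hs ht hst
    refine ciSup_le fun p => ?_
    have h1 := mul_le_mul_of_nonneg_left (le_ciSup (hbdd z) p) hs
    have h2 := mul_le_mul_of_nonneg_left (le_ciSup (hbdd z') p) ht
    have e1 := hdiff p (s • z + t • z') 0
    have e2 := hdiff p z 0
    have e3 := hdiff p z' 0
    simp only [sub_zero, inner_add_right, inner_smul_right] at e1 e2 e3
    simp only [smul_eq_mul]
    have : a p (s • z + t • z') = s * a p z + t * a p z' := by
      rw [e1, e2, e3]
      linear_combination (- a p 0) * hst
    linarith
  · refine LipschitzWith.of_le_add_mul r fun z z' => ?_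
    refine ciSup_le fun p => ?_
    rw [dist_eq_norm]
    exact (hlip p z z').trans (by gcongr; exact le_ciSup (hbdd z') p)
  · intro x hx z
    rw [← le_sub_iff_add_le]
    refine ciSup_le fun p => ?_
    rw [le_sub_iff_add_le]
    let q : ι := ⟨(fun i => if i ≤ p.1.2 then p.1.1 i else ⟨x, hx⟩, p.1.2 + 1), by
      simpa using p.2⟩
    have hq : a q z = a p (W x) + ⟪x, z - W x⟫ := by
      simp only [a, b, q, Finset.sum_range_succ]
      have : ∀ i ∈ Finset.range p.1.2, i ≤ p.1.2 ∧ i + 1 ≤ p.1.2 := fun i hi => by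
        have := Finset.mem_range.1 hi
        omega
      rw [Finset.sum_congr rfl fun i hi => by
        rw [if_pos (this i hi).1, if_pos (this i hi).2]]
      simp
    rw [← hq]
    exact le_ciSup (hbdd z) q

/-- The proximal map of a Lipschitz convex function: its complement `G` is the gradient of the
Moreau envelope, and it is firmly nonexpansive. -/
theorem exists_moreau_gradient [FiniteDimensional ℝ E] {v : E → ℝ} {r : ℝ≥0}
    (hconv : ConvexOn ℝ Set.univ v) (hlip : LipschitzWith r v) :
    ∃ (G : E → E) (M : E → ℝ),
      (∀ y, HasFDerivAt M (innerSL ℝ (G y)) y) ∧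
      (∀ y y', ‖G y - G y'‖ ^ 2 ≤ ⟪y - y', G y - G y'⟫) ∧
      ∀ x w, (∀ z, v w + ⟪x, z - w⟫ ≤ v z) → G (x + w) = x := by
  have hmin : ∀ y, ∃ p, ∀ z, ‖y - p‖ ^ 2 / 2 + v p ≤ ‖y - z‖ ^ 2 / 2 + v z := by
    intro y
    have hc := hlip.continuous
    refine Continuous.exists_forall_le' (by fun_prop) y ?_
    filter_upwards [(tendsto_norm_cocompact_atTop (E := E)).eventually_ge_atTop (‖y‖ + 2 * r)]
      with z hz
    have h1 : v y ≤ v z + r * ‖y - z‖ := by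
      have := hlip.le_add_mul y z
      rwa [dist_eq_norm] at this
    have h2 : 2 * (r : ℝ) ≤ ‖y - z‖ := by
      have := norm_sub_norm_le z y
      rw [norm_sub_rev] at this
      linarith
    simp only [sub_self, norm_zero]
    nlinarith [norm_nonneg (y - z)]
  choose p hp using hmin
  have hsub : ∀ y z, v (p y) + ⟪y - p y, z - p y⟫ ≤ v z := by
    intro y z
    have key : ∀ t : ℝ, 0 < t → t ≤ 1 →
        v (p y) + ⟪y - p y, z - p y⟫ ≤ v z + t * (‖z - p y‖ ^ 2 / 2) := by
      intro t ht ht1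
      have h1 := hp y ((1 - t) • p y + t • z)
      have h2 := hconv.2 (Set.mem_univ (p y)) (Set.mem_univ z) (sub_nonneg.2 ht1) ht.le (by ring)
      have h3 : y - ((1 - t) • p y + t • z) = (y - p y) - t • (z - p y) := by module
      rw [h3, norm_sub_sq_real (y - p y) (t • (z - p y)), inner_smul_right, norm_smul, Real.norm_of_nonneg ht.le] at h1
      simp only [smul_eq_mul] at h2
      have : t * (v (p y) + ⟪y - p y, z - p y⟫) ≤ t * (v z + t * (‖z - p y‖ ^ 2 / 2)) := by
        nlinarith
      exact le_of_mul_le_mul_left this ht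
    have hlim : Tendsto (fun t : ℝ => v z + t * (‖z - p y‖ ^ 2 / 2)) (𝓝[>] 0)
        (𝓝 (v z + 0 * (‖z - p y‖ ^ 2 / 2))) := by
      refine Tendsto.mono_left ?_ nhdsWithin_le_nhds
      exact Continuous.tendsto (by fun_prop) 0
    rw [zero_mul, add_zero] at hlim
    refine ge_of_tendsto hlim ?_
    filter_upwards [Ioc_mem_nhdsGT (zero_lt_one' ℝ)] with t ht
    exact key t ht.1 ht.2
  have hfirm : ∀ x w y, (∀ z, v w + ⟪x, z - w⟫ ≤ v z) → 0 ≤ ⟪x - (y - p y), w - p y⟫ := by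
    intro x w y h
    have h1 := h (p y)
    have h2 := hsub y w
    simp only [inner_sub_left, inner_sub_right] at *
    linarith
  have hG : ∀ y y', ‖(y - p y) - (y' - p y')‖ ^ 2 ≤ ⟪y - y', (y - p y) - (y' - p y')⟫ := by
    intro y y'
    have := hfirm (y - p y) (p y) y' (hsub y)
    rw [real_inner_comm] at this
    have e : p y - p y' = (y - y') - ((y - p y) - (y' - p y')) := by abel
    rw [e, inner_sub_left, real_inner_self_eq_norm_sq] at this
    linarith
  refine ⟨fun y => y - p y, fun y => ‖y - p y‖ ^ 2 / 2 + v (p y), ?_, hG, ?_⟩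
  · intro y
    have hup : ∀ y y', ‖y' - p y'‖ ^ 2 / 2 + v (p y') - (‖y - p y‖ ^ 2 / 2 + v (p y)) ≤
        ⟪y - p y, y' - y⟫ + ‖y' - y‖ ^ 2 / 2 := by
      intro y y'
      have := hp y' (p y)
      have e : y' - p y = (y - p y) + (y' - y) := by abel
      rw [e, norm_add_sq_real] at this
      linarith
    rw [hasFDerivAt_iff_isLittleO_nhds_zero]
    refine Asymptotics.IsBigO.trans_isLittleO (g := fun h : E => ‖h‖ ^ 2) ?_ ?_
    · refine Asymptotics.IsBigO.of_bound (3 / 2) (Eventually.of_forall fun h => ?_)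
      have h1 := hup y (y + h)
      have h2 := hup (y + h) y
      have h3 := hG (y + h) y
      have h4 := real_inner_le_norm (y + h - y) ((y + h - p (y + h)) - (y - p y))
      have e1 : y + h - y = h := by abel
      have e2 : y - (y + h) = -h := by abel
      rw [e1] at h1 h3 h4
      rw [e2, norm_neg, inner_neg_right] at h2
      have h5 : ‖(y + h - p (y + h)) - (y - p y)‖ ≤ ‖h‖ := by
        by_contra! hcon
        nlinarith [norm_nonneg h]
      have h6 : |⟪h, (y + h - p (y + h)) - (y - p y)⟫| ≤ ‖h‖ ^ 2 :=
        (abs_real_inner_le_norm _ _).trans (by nlinarith [norm_nonneg h])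
      rw [inner_sub_right, abs_le] at h6
      rw [real_inner_comm (y + h - p (y + h)), real_inner_comm (y - p y)] at h6
      simp only [innerSL_apply_apply, norm_pow, Real.norm_eq_abs, abs_norm]
      rw [abs_le]
      constructor <;> linarith [h6.1, h6.2]
    · simpa using (Asymptotics.isLittleO_norm_pow_id (E' := E) one_lt_two)
  · intro x w h
    have h1 := hfirm x w (x + w) h
    have e : x - (x + w - p (x + w)) = -(w - p (x + w)) := by abel
    rw [e, inner_neg_left, real_inner_self_eq_norm_sq] at h1
    have : w - p (x + w) = 0 := by
      rw [← norm_eq_zero]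
      nlinarith [norm_nonneg (w - p (x + w))]
    change x + w - p (x + w) = x
    rw [← sub_eq_zero.1 this, add_sub_cancel_right]

end Convexity

section Determinants

open scoped RealInnerProductSpace NNReal
open Filter Topology

variable {E : Type*} [NormedAddCommGroup E] [InnerProductSpace ℝ E]

theorem prod_le_inv_one_add_pow {n : ℕ} {s : ℝ} (hs : 0 < s) {a : Fin n → ℝ}
    (h0 : ∀ i, 0 ≤ a i) (h1 : ∀ i, a i ≤ 1) (h : ∏ i, a i ≤ ∏ i, (1 - a i) / s) :
    ∏ i, a i ≤ ((1 + s) ^ n)⁻¹ := by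
  have hw : 1 / (1 + s) + s / (1 + s) = 1 := by field_simp
  have hb : ∀ i, 0 ≤ (1 - a i) / s := fun i => div_nonneg (sub_nonneg.2 (h1 i)) hs.le
  have hA : 0 ≤ ∏ i, a i := Finset.prod_nonneg fun i _ => h0 i
  have hB : 0 ≤ ∏ i, (1 - a i) / s := Finset.prod_nonneg fun i _ => hb i
  calc ∏ i, a i = (∏ i, a i) ^ (1 / (1 + s)) * (∏ i, a i) ^ (s / (1 + s)) := by
        rw [← Real.rpow_add_of_nonneg hA (by positivity) (by positivity), hw, Real.rpow_one]
    _ ≤ (∏ i, a i) ^ (1 / (1 + s)) * (∏ i, (1 - a i) / s) ^ (s / (1 + s)) := by gcongr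
    _ = ∏ i, (a i ^ (1 / (1 + s)) * ((1 - a i) / s) ^ (s / (1 + s))) := by
        rw [Finset.prod_mul_distrib, Real.finsetProd_rpow _ _ fun i _ => h0 i,
          Real.finsetProd_rpow _ _ fun i _ => hb i]
    _ ≤ ∏ _i : Fin n, (1 + s)⁻¹ := by
        refine Finset.prod_le_prod (fun i _ => mul_nonneg (Real.rpow_nonneg (h0 i) _)
          (Real.rpow_nonneg (hb i) _)) fun i _ => ?_
        refine (Real.geom_mean_le_arith_mean2_weighted (by positivity) (by positivity) (h0 i) (hb i)
          hw).trans_eq ?_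
        field_simp
        ring
    _ = ((1 + s) ^ n)⁻¹ := by simp

/-- For a symmetric operator `A` with `0 ≤ A ≤ 1`, comparing the determinants of `A` and
`s⁻¹ (1 - A)` bounds `det A`. -/
theorem LinearMap.IsSymmetric.abs_det_le_of_abs_det_le [FiniteDimensional ℝ E] {A : E →ₗ[ℝ] E}
    (hA : A.IsSymmetric) (hfirm : ∀ v, ‖A v‖ ^ 2 ≤ ⟪v, A v⟫) {s : ℝ} (hs : 0 < s)
    (h : |LinearMap.det A| ≤ |LinearMap.det (s⁻¹ • (LinearMap.id - A))|) :
    |LinearMap.det A| ≤ ((1 + s) ^ Module.finrank ℝ E)⁻¹ := by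
  set n := Module.finrank ℝ E with hn
  set b := hA.eigenvectorBasis hn.symm with hb
  set a := hA.eigenvalues hn.symm with ha
  have hAb : ∀ i, A (b i) = a i • b i := fun i => hA.apply_eigenvectorBasis hn.symm i
  have hdet : ∀ (B : E →ₗ[ℝ] E) (d : Fin n → ℝ), (∀ i, B (b i) = d i • b i) →
      LinearMap.det B = ∏ i, d i := by
    intro B d hd
    rw [← LinearMap.det_toMatrix b.toBasis, ← Matrix.det_diagonal]
    congr 1
    ext i j
    rw [LinearMap.toMatrix_apply]
    simp only [OrthonormalBasis.coe_toBasis, hd, map_smul, Finsupp.smul_apply, smul_eq_mul,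
      OrthonormalBasis.coe_toBasis_repr_apply, OrthonormalBasis.repr_self, Matrix.diagonal_apply]
    by_cases hij : i = j
    · simp [hij]
    · simp [hij]
  have hsq : ∀ i, a i ^ 2 ≤ a i := by
    intro i
    have := hfirm (b i)
    rw [hAb, norm_smul, inner_smul_right, real_inner_self_eq_norm_sq, b.norm_eq_one] at this
    simpa using this
  have h0 : ∀ i, 0 ≤ a i := fun i => (sq_nonneg _).trans (hsq i)
  have h1 : ∀ i, a i ≤ 1 := fun i => by nlinarith [hsq i, h0 i]
  rw [hdet A a hAb, hdet (s⁻¹ • (LinearMap.id - A)) (fun i => (1 - a i) / s) (fun i => by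
      simp only [LinearMap.smul_apply, LinearMap.sub_apply, LinearMap.id_apply, hAb]
      rw [div_eq_inv_mul, mul_smul, sub_smul, one_smul]),
    abs_of_nonneg (Finset.prod_nonneg fun i _ => h0 i),
    abs_of_nonneg (Finset.prod_nonneg fun i _ => div_nonneg (sub_nonneg.2 (h1 i)) hs.le)] at h
  rw [hdet A a hAb, abs_of_nonneg (Finset.prod_nonneg fun i _ => h0 i)]
  exact prod_le_inv_one_add_pow hs h0 h1 h

theorem norm_sq_le_inner_of_hasFDerivAt {G : E → E}
    (hG : ∀ y y', ‖G y - G y'‖ ^ 2 ≤ ⟪y - y', G y - G y'⟫) {A : E →L[ℝ] E} {y : E}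
    (hA : HasFDerivAt G A y) (v : E) : ‖A v‖ ^ 2 ≤ ⟪v, A v⟫ := by
  have hl := (hA.hasLineDerivAt v).tendsto_slope_zero_right
  have h1 : Tendsto (fun t : ℝ => ⟪v, t⁻¹ • (G (y + t • v) - G y)⟫) (𝓝[>] 0) (𝓝 ⟪v, A v⟫) :=
    tendsto_const_nhds.inner hl
  refine le_of_tendsto_of_tendsto (hl.norm.pow 2) h1 ?_
  filter_upwards [self_mem_nhdsWithin] with t (ht : 0 < t)
  have := hG (y + t • v) y
  rw [add_sub_cancel_left, real_inner_smul_left] at this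
  rw [norm_smul, inner_smul_right, mul_pow, norm_inv, Real.norm_of_nonneg ht.le]
  have h2 : (t⁻¹) ^ 2 * ‖G (y + t • v) - G y‖ ^ 2 ≤
      (t⁻¹) ^ 2 * (t * ⟪v, G (y + t • v) - G y⟫) := by gcongr
  refine h2.trans_eq ?_
  field_simp

theorem isSymmetric_of_hasFDerivAt_gradient {G : E → E} {M : E → ℝ}
    (hM : ∀ y, HasFDerivAt M (innerSL ℝ (G y)) y) {A : E →L[ℝ] E} {y : E}
    (hA : HasFDerivAt G A y) : (A : E →ₗ[ℝ] E).IsSymmetric := by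
  intro v w
  have h := second_derivative_symmetric (𝕜 := ℝ) (f' := fun y => innerSL ℝ (G y)) hM
    ((innerSL ℝ).hasFDerivAt.comp y hA) v w
  have h' : ⟪A v, w⟫ = ⟪A w, v⟫ := h
  change ⟪A v, w⟫ = ⟪v, A w⟫
  rw [h', real_inner_comm]

end Determinants

section DensityBound

open scoped RealInnerProductSpace NNReal ENNReal
open Filter Topology

variable {E : Type*} [NormedAddCommGroup E] [InnerProductSpace ℝ E] [FiniteDimensional ℝ E]
  [MeasurableSpace E] [BorelSpace E] (μ : Measure E) [μ.IsAddHaarMeasure]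

theorem LipschitzWith.addHaar_image_eq_zero {G : E → E} {K : ℝ≥0} (hG : LipschitzWith K G)
    {N : Set E} (hN : μ N = 0) : μ (G '' N) = 0 := by
  have h := hG.hausdorffMeasure_image_le (d := Module.finrank ℝ E) (Nat.cast_nonneg _) N
  rw [Measure.absolutelyContinuous_isAddHaarMeasure
    (Measure.hausdorffMeasure (Module.finrank ℝ E)) μ hN, mul_zero, nonpos_iff_eq_zero] at h
  exact Measure.absolutelyContinuous_isAddHaarMeasure μ _ h

/-- If `T` is cyclically monotone and does not increase volume density, then `x ↦ x + s T x`
pushes the volume forward to a measure of density at most `(1 + s) ^ (-n)`. -/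
theorem CyclicallyMonotoneOn.measure_preimage_add_smul_le {T : E → E} {X : Set E} {r : ℝ≥0}
    (hX : MeasurableSet X) (hXr : ∀ x ∈ X, ‖x‖ ≤ r) (hT : Measurable T)
    (hmono : CyclicallyMonotoneOn T X)
    (hpush : ∀ A, MeasurableSet A → μ (X ∩ T ⁻¹' A) ≤ μ A) {s : ℝ} (hs : 0 < s)
    {F : Set E} (hF : MeasurableSet F) :
    μ (X ∩ (fun x => x + s • T x) ⁻¹' F) ≤
      ENNReal.ofReal ((1 + s) ^ Module.finrank ℝ E)⁻¹ * μ F := by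
  rcases X.eq_empty_or_nonempty with rfl | hne
  · simp
  have hmono' : CyclicallyMonotoneOn (fun x => s • T x) X := by
    intro c hc k
    have h := mul_nonpos_of_nonneg_of_nonpos hs.le (hmono c hc k)
    simp only [← smul_sub, inner_smul_right, ← Finset.mul_sum, ← mul_add]
    exact h
  obtain ⟨v, hconv, hlip, hsub⟩ := hmono'.exists_convex_potential hne hXr
  obtain ⟨G, M, hM, hG, hGX⟩ := exists_moreau_gradient hconv hlip
  have hGX' : ∀ x ∈ X, G (x + s • T x) = x := fun x hx => hGX x (s • T x) (hsub x hx)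
  have hGlip : LipschitzWith 1 G := by
    refine LipschitzWith.of_dist_le_mul fun y y' => ?_
    rw [dist_eq_norm, dist_eq_norm, NNReal.coe_one, one_mul]
    have h1 := hG y y'
    have h2 := real_inner_le_norm (y - y') (G y - G y')
    by_contra! hcon
    nlinarith [norm_nonneg (y - y')]
  have hGm : Measurable G := hGlip.continuous.measurable
  set H : E → E := fun y => s⁻¹ • (y - G y) with hH
  have hHm : Measurable H := by fun_prop
  have hHX : ∀ x ∈ X, H (x + s • T x) = T x := by
    intro x hx
    simp only [hH, hGX' x hx, add_sub_cancel_left]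
    rw [smul_smul, inv_mul_cancel₀ hs.ne', one_smul]
  set S : Set E := {y | DifferentiableAt ℝ G y} ∩ (G ⁻¹' X ∩ {y | T (G y) = H y}) with hS
  have hSm : MeasurableSet S := (measurableSet_of_differentiableAt ℝ G).inter
    ((hGm hX).inter (measurableSet_eq_fun (hT.comp hGm) hHm))
  have hrec : ∀ y ∈ S, G y + s • T (G y) = y := by
    rintro y ⟨-, -, hy : T (G y) = H y⟩
    rw [hy, hH, smul_smul, mul_inv_cancel₀ hs.ne', one_smul, add_sub_cancel]
  have hinj : Set.InjOn G S := by
    intro y hy y' hy' h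
    rw [← hrec y hy, ← hrec y' hy', h]
  set H' : E → E →L[ℝ] E := fun y => s⁻¹ • (ContinuousLinearMap.id ℝ E - fderiv ℝ G y) with hH'
  have hdG : ∀ y ∈ S, HasFDerivAt G (fderiv ℝ G y) y := fun y hy => hy.1.hasFDerivAt
  have hdH : ∀ y ∈ S, HasFDerivAt H (H' y) y := fun y hy =>
    ((hasFDerivAt_id y).sub (hdG y hy)).const_smul s⁻¹
  have hmf : Measurable fun y => ENNReal.ofReal |(fderiv ℝ G y).det| :=
    (ContinuousLinearMap.continuous_det.measurable.comp (measurable_fderiv ℝ G)).abs.ennreal_ofReal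
  have hmh : Measurable fun y => ENNReal.ofReal |(H' y).det| := by
    have : Measurable H' := (measurable_const.sub (measurable_fderiv ℝ G)).const_smul s⁻¹
    exact (ContinuousLinearMap.continuous_det.measurable.comp this).abs.ennreal_ofReal
  have himage : ∀ A ⊆ S, MeasurableSet A →
      ∫⁻ y in A, ENNReal.ofReal |(fderiv ℝ G y).det| ∂μ = μ (G '' A) := fun A hAS hA =>
    lintegral_abs_det_fderiv_eq_addHaar_image μ hA
      (fun y hy => (hdG y (hAS hy)).hasFDerivWithinAt) (hinj.mono hAS)
  have hcomp : ∀ A ⊆ S, MeasurableSet A →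
      ∫⁻ y in A, ENNReal.ofReal |(fderiv ℝ G y).det| ∂μ ≤
        ∫⁻ y in A, ENNReal.ofReal |(H' y).det| ∂μ := by
    intro A hAS hA
    rw [himage A hAS hA]
    calc μ (G '' A) ≤ μ (X ∩ T ⁻¹' toMeasurable μ (H '' A)) := by
          refine measure_mono ?_
          rintro _ ⟨y, hy, rfl⟩
          refine ⟨(hAS hy).2.1, subset_toMeasurable μ _ ?_⟩
          rw [(hAS hy).2.2]
          exact Set.mem_image_of_mem H hy
      _ ≤ μ (toMeasurable μ (H '' A)) := hpush _ (measurableSet_toMeasurable _ _)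
      _ = μ (H '' A) := measure_toMeasurable _
      _ ≤ _ := addHaar_image_le_lintegral_abs_det_fderiv μ hA
          fun y hy => (hdH y (hAS hy)).hasFDerivWithinAt
  have hae : ∀ᵐ y ∂μ.restrict S,
      ENNReal.ofReal |(fderiv ℝ G y).det| ≤ ENNReal.ofReal |(H' y).det| := by
    refine ae_le_of_forall_setLIntegral_le_of_sigmaFinite hmf fun A hA _ => ?_
    rw [Measure.restrict_restrict hA]
    exact hcomp _ Set.inter_subset_right (hA.inter hSm)
  have hbound : ∀ᵐ y ∂μ.restrict S, ENNReal.ofReal |(fderiv ℝ G y).det| ≤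
      ENNReal.ofReal ((1 + s) ^ Module.finrank ℝ E)⁻¹ := by
    filter_upwards [hae, ae_restrict_mem hSm] with y hy hyS
    refine ENNReal.ofReal_le_ofReal ?_
    rw [ENNReal.ofReal_le_ofReal_iff (abs_nonneg _)] at hy
    exact (isSymmetric_of_hasFDerivAt_gradient hM (hdG y hyS)).abs_det_le_of_abs_det_le
      (norm_sq_le_inner_of_hasFDerivAt hG (hdG y hyS)) hs hy
  have hnull : μ (G '' {y | ¬ DifferentiableAt ℝ G y}) = 0 :=
    hGlip.addHaar_image_eq_zero μ (ae_iff.1 hGlip.ae_differentiableAt)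
  calc μ (X ∩ (fun x => x + s • T x) ⁻¹' F)
      ≤ μ (G '' (S ∩ F) ∪ G '' {y | ¬ DifferentiableAt ℝ G y}) := by
        refine measure_mono ?_
        rintro x ⟨hx, hxF : x + s • T x ∈ F⟩
        by_cases hd : DifferentiableAt ℝ G (x + s • T x)
        · refine Or.inl ⟨x + s • T x, ⟨⟨hd, ?_, ?_⟩, hxF⟩, hGX' x hx⟩
          · rw [Set.mem_preimage, hGX' x hx]; exact hx
          · rw [Set.mem_ofPred_eq, hGX' x hx, hHX x hx]
        · exact Or.inr ⟨x + s • T x, hd, hGX' x hx⟩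
    _ ≤ μ (G '' (S ∩ F)) + 0 := hnull ▸ measure_union_le _ _
    _ = ∫⁻ y in S ∩ F, ENNReal.ofReal |(fderiv ℝ G y).det| ∂μ := by
        rw [add_zero, himage _ Set.inter_subset_left (hSm.inter hF)]
    _ ≤ ∫⁻ _ in S ∩ F, ENNReal.ofReal ((1 + s) ^ Module.finrank ℝ E)⁻¹ ∂μ :=
        lintegral_mono_ae (ae_restrict_of_ae_restrict_of_subset Set.inter_subset_left hbound)
    _ ≤ _ := by
        rw [setLIntegral_const]
        gcongr
        exact Set.inter_subset_right

end DensityBound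

section Optimality

open scoped RealInnerProductSpace NNReal ENNReal
open Filter Topology

variable {E : Type*} [NormedAddCommGroup E]

/-- The map translating each closed ball `closedBall (b i) ρ` onto `closedBall (b (σ i)) ρ` and
fixing every other point, provided that these balls are disjoint. -/
noncomputable def permuteBalls {ι : Type*} [Fintype ι] (σ : Equiv.Perm ι) (b : ι → E) (ρ : ℝ)
    (x : E) : E :=
  x + ∑ i, (Metric.closedBall (b i) ρ).indicator (fun _ => b (σ i) - b i) x

theorem preimage_add_sub_closedBall (u v : E) (ρ : ℝ) :
    (fun x => x + (v - u)) ⁻¹' Metric.closedBall v ρ = Metric.closedBall u ρ := by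
  ext x
  simp only [Set.mem_preimage, Metric.mem_closedBall, dist_eq_norm]
  rw [show x + (v - u) - v = x - u by abel]

section PermuteBalls

variable {ι : Type*} [Fintype ι] {σ : Equiv.Perm ι} {b : ι → E} {ρ : ℝ}

theorem permuteBalls_of_mem (hd : Pairwise fun i j =>
      Disjoint (Metric.closedBall (b i) ρ) (Metric.closedBall (b j) ρ)) {i : ι} {x : E}
    (hx : x ∈ Metric.closedBall (b i) ρ) : permuteBalls σ b ρ x = x + (b (σ i) - b i) := by
  rw [permuteBalls, Finset.sum_eq_single i, Set.indicator_of_mem hx]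
  · intro j _ hj
    exact Set.indicator_of_notMem (Set.disjoint_left.1 (hd hj.symm) hx) _
  · simp

theorem permuteBalls_of_notMem {x : E} (hx : ∀ i, x ∉ Metric.closedBall (b i) ρ) :
    permuteBalls σ b ρ x = x := by
  rw [permuteBalls, Finset.sum_eq_zero fun i _ => Set.indicator_of_notMem (hx i) _, add_zero]

variable [MeasurableSpace E] [BorelSpace E]

theorem measurable_permuteBalls [SecondCountableTopology E] :
    Measurable (permuteBalls σ b ρ) := by
  refine measurable_id.add (Finset.measurable_fun_sum _ fun i _ => ?_)
  exact measurable_const.indicator Metric.isClosed_closedBall.measurableSet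

variable (μ : Measure E) [μ.IsAddRightInvariant]

theorem measurePreserving_permuteBalls [SecondCountableTopology E] {B : Set E}
    (hd : Pairwise fun i j =>
      Disjoint (Metric.closedBall (b i) ρ) (Metric.closedBall (b j) ρ))
    (hB : ∀ i, Metric.closedBall (b i) ρ ⊆ B) :
    MeasurePreserving (permuteBalls σ b ρ) (μ.restrict B) (μ.restrict B) := by
  refine ⟨measurable_permuteBalls, ?_⟩
  set Q : ι → Set E := fun i => Metric.closedBall (b i) ρ with hQ
  have hQm : ∀ i, MeasurableSet (Q i) := fun i => Metric.isClosed_closedBall.measurableSet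
  have hUm : MeasurableSet (⋃ i, Q i) := MeasurableSet.iUnion hQm
  have hsplit : μ.restrict B = μ.restrict (B \ ⋃ i, Q i) + ∑ i, μ.restrict (Q i) := by
    rw [← Measure.sum_fintype, ← Measure.restrict_iUnion hd hQm,
      ← Measure.restrict_union Set.disjoint_sdiff_left hUm,
      Set.sdiff_union_of_subset (Set.iUnion_subset hB)]
  have hfix : (μ.restrict (B \ ⋃ i, Q i)).map (permuteBalls σ b ρ) =
      μ.restrict (B \ ⋃ i, Q i) := by
    have : permuteBalls σ b ρ =ᵐ[μ.restrict (B \ ⋃ i, Q i)] id := by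
      have h0 : ∀ᵐ x ∂μ.restrict (⋃ i, Q i)ᶜ, permuteBalls σ b ρ x = id x := by
        filter_upwards [ae_restrict_mem hUm.compl] with x hx
        exact permuteBalls_of_notMem fun i hi => hx (Set.mem_iUnion.2 ⟨i, hi⟩)
      exact ae_restrict_of_ae_restrict_of_subset (fun x hx => hx.2) h0
    rw [Measure.map_congr this, Measure.map_id]
  have hmove : ∀ i, (μ.restrict (Q i)).map (permuteBalls σ b ρ) = μ.restrict (Q (σ i)) := by
    intro i
    have h1 : permuteBalls σ b ρ =ᵐ[μ.restrict (Q i)] fun x => x + (b (σ i) - b i) := by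
      filter_upwards [ae_restrict_mem (hQm i)] with x hx
      exact permuteBalls_of_mem hd hx
    rw [Measure.map_congr h1]
    have h2 := ((measurePreserving_add_right μ (b (σ i) - b i)).restrict_preimage (hQm (σ i))).map_eq
    rwa [preimage_add_sub_closedBall] at h2
  rw [hsplit, Measure.map_add _ _ measurable_permuteBalls,
    Measure.map_finset_sum measurable_permuteBalls.aemeasurable, hfix]
  simp only [hmove]
  rw [Equiv.sum_comp σ fun i => μ.restrict (Q i)]

theorem integral_inner_permuteBalls [InnerProductSpace ℝ E] [CompleteSpace E]
    {B : Set E} {T : E → E} (hT : IntegrableOn T B μ)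
    (hd : Pairwise fun i j =>
      Disjoint (Metric.closedBall (b i) ρ) (Metric.closedBall (b j) ρ))
    (hB : ∀ i, Metric.closedBall (b i) ρ ⊆ B) :
    ∫ x in B, ⟪permuteBalls σ b ρ x - x, T (permuteBalls σ b ρ x)⟫ ∂μ =
      ∑ i, ⟪b (σ i) - b i, ∫ x in Metric.closedBall (b (σ i)) ρ, T x ∂μ⟫ := by
  have hQm : ∀ i, MeasurableSet (Metric.closedBall (b i) ρ) :=
    fun i => Metric.isClosed_closedBall.measurableSet
  have hpt : ∀ x, ⟪permuteBalls σ b ρ x - x, T (permuteBalls σ b ρ x)⟫ =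
      ∑ i, (Metric.closedBall (b i) ρ).indicator
        (fun x => ⟪b (σ i) - b i, T (x + (b (σ i) - b i))⟫) x := by
    intro x
    by_cases hx : ∃ i, x ∈ Metric.closedBall (b i) ρ
    · obtain ⟨i, hi⟩ := hx
      rw [permuteBalls_of_mem hd hi, add_sub_cancel_left, Finset.sum_eq_single i,
        Set.indicator_of_mem hi]
      · intro j _ hj
        exact Set.indicator_of_notMem (Set.disjoint_left.1 (hd hj.symm) hi) _
      · simp
    · push Not at hx
      rw [permuteBalls_of_notMem hx, sub_self, inner_zero_left,
        Finset.sum_eq_zero fun i _ => Set.indicator_of_notMem (hx i) _]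
  have hmp : ∀ i, MeasurePreserving (fun x => x + (b (σ i) - b i))
      (μ.restrict (Metric.closedBall (b i) ρ)) (μ.restrict (Metric.closedBall (b (σ i)) ρ)) := by
    intro i
    have h2 := (measurePreserving_add_right μ (b (σ i) - b i)).restrict_preimage (hQm (σ i))
    rwa [preimage_add_sub_closedBall] at h2
  have hTi : ∀ i, IntegrableOn T (Metric.closedBall (b i) ρ) μ := fun i => hT.mono_set (hB i)
  simp_rw [hpt]
  rw [integral_finsetSum]
  · refine Finset.sum_congr rfl fun i _ => ?_
    rw [setIntegral_indicator (hQm i), Set.inter_eq_right.2 (hB i), ← integral_inner (hTi (σ i))]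
    exact (hmp i).integral_comp (measurableEmbedding_addRight _)
      fun x => ⟪b (σ i) - b i, T x⟫
  · intro i _
    rw [integrable_indicator_iff (hQm i)]
    refine Integrable.const_inner (𝕜 := ℝ) _ ?_
    rw [Measure.restrict_restrict (hQm i), Set.inter_eq_left.2 (hB i)]
    exact (hmp i).integrable_comp_of_integrable (hTi (σ i))

end PermuteBalls

variable [InnerProductSpace ℝ E] [FiniteDimensional ℝ E] [MeasurableSpace E] [BorelSpace E]
  (μ : Measure E) [μ.IsAddHaarMeasure]

/-- Lebesgue differentiation along closed balls whose centers stay within a bounded multiple of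
their radius. -/
theorem ae_forall_tendsto_setAverage_closedBall {f : E → E} (hf : Integrable f μ) :
    ∀ᵐ x ∂μ, ∀ (K : ℕ) (w : ℕ → E) (δ : ℕ → ℝ), Tendsto δ atTop (𝓝[>] 0) →
      (∀ j, x ∈ Metric.closedBall (w j) (K * δ j)) →
      Tendsto (fun j => ⨍ y in Metric.closedBall (w j) (δ j), f y ∂μ) atTop (𝓝 (f x)) := by
  rw [ae_all_iff]
  intro K
  filter_upwards [IsUnifLocDoublingMeasure.ae_tendsto_average μ hf.locallyIntegrable K]
    with x hx w δ hδ hw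
  exact hx w δ hδ (Eventually.of_forall hw)

/-- A transport map whose correlation with the identity cannot be increased by rearranging its
domain is cyclically monotone on a set of full measure. -/
theorem exists_cyclicallyMonotoneOn_of_forall_measurePreserving [Nontrivial E] {B : Set E}
    (hBo : IsOpen B) {T : E → E} (hT : IntegrableOn T B μ)
    (hopt : ∀ R : E → E, MeasurePreserving R (μ.restrict B) (μ.restrict B) →
      0 ≤ ∫ x in B, ⟪R x - x, T (R x)⟫ ∂μ) :
    ∃ X ⊆ B, MeasurableSet X ∧ μ (B \ X) = 0 ∧ CyclicallyMonotoneOn T X := by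
  have hae := ae_forall_tendsto_setAverage_closedBall μ
    ((integrable_indicator_iff hBo.measurableSet).2 hT)
  obtain ⟨L, hL, hLm, hL0⟩ := exists_measurable_superset_of_null (ae_iff.1 hae)
  refine ⟨B \ L, Set.sdiff_subset, hBo.measurableSet.diff hLm,
    measure_mono_null (fun x hx => by by_contra h; exact hx.2 ⟨hx.1, h⟩) hL0, ?_⟩
  intro c hc k
  have hleb : ∀ i (K : ℕ) (w : ℕ → E) (δ : ℕ → ℝ), Tendsto δ atTop (𝓝[>] 0) →
      (∀ j, c i ∈ Metric.closedBall (w j) (K * δ j)) →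
      Tendsto (fun j => ⨍ y in Metric.closedBall (w j) (δ j), B.indicator T y ∂μ) atTop
        (𝓝 (T (c i))) := by
    intro i
    have h := not_not.1 fun h => (hc i).2 (hL h)
    rwa [Set.indicator_of_mem (hc i).1] at h
  obtain ⟨e, he⟩ := exists_norm_eq E zero_le_one
  let σ : Equiv.Perm (Fin (k + 1)) := finRotate (k + 1)
  let b : ℝ → Fin (k + 1) → E := fun ρ i => c i + (3 * (i : ℕ) * ρ) • e
  have hbc : ∀ i, Continuous fun ρ => b ρ i := fun i => by fun_prop
  have hb0 : ∀ i, b 0 i = c i := fun i => by simp [b]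
  have hbdist : ∀ (i : Fin (k + 1)) ρ, 0 ≤ ρ → dist (c i) (b ρ i) ≤ ((3 * (k + 1) : ℕ) : ℝ) * ρ := by
    intro i ρ hρ
    rw [dist_eq_norm, show c i - b ρ i = -((3 * (i : ℕ) * ρ) • e) by simp [b], norm_neg,
      norm_smul, he, Real.norm_of_nonneg (by positivity), mul_one]
    have : ((i : ℕ) : ℝ) ≤ k + 1 := by exact_mod_cast i.2.le
    push_cast
    gcongr
  have hsub : ∀ i, ∀ᶠ ρ in 𝓝[>] (0 : ℝ), Metric.closedBall (b ρ i) ρ ⊆ B := by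
    intro i
    obtain ⟨ε, hε, hεB⟩ := Metric.isOpen_iff.1 hBo (c i) (hc i).1
    have h1 : Tendsto (fun ρ : ℝ => dist (b ρ i) (c i) + ρ) (𝓝[>] 0) (𝓝 0) := by
      have : Continuous fun ρ : ℝ => dist (b ρ i) (c i) + ρ := by fun_prop
      have h := this.tendsto 0
      simp only [hb0, dist_self, add_zero] at h
      exact h.mono_left nhdsWithin_le_nhds
    filter_upwards [h1.eventually_lt_const hε] with ρ hρ x hx
    refine hεB ?_
    rw [Metric.mem_ball]
    rw [Metric.mem_closedBall] at hx
    linarith [dist_triangle x (b ρ i) (c i)]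
  have hdis : ∀ i j, i ≠ j → ∀ᶠ ρ in 𝓝[>] (0 : ℝ),
      Disjoint (Metric.closedBall (b ρ i) ρ) (Metric.closedBall (b ρ j) ρ) := by
    intro i j hij
    suffices h : ∀ᶠ ρ in 𝓝[>] (0 : ℝ), ρ + ρ < dist (b ρ i) (b ρ j) by
      filter_upwards [h] with ρ hρ using Metric.closedBall_disjoint_closedBall hρ
    by_cases hcij : c i = c j
    · filter_upwards [self_mem_nhdsWithin] with ρ (hρ : 0 < ρ)
      have h1 : b ρ i - b ρ j = (3 * (((i : ℕ) : ℤ) - ((j : ℕ) : ℤ) : ℤ) * ρ) • e := by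
        simp only [b, hcij]
        push_cast
        module
      have h2 : (1 : ℝ) ≤ |((((i : ℕ) : ℤ) - ((j : ℕ) : ℤ) : ℤ) : ℝ)| := by
        have : (1 : ℤ) ≤ |((i : ℕ) : ℤ) - ((j : ℕ) : ℤ)| := by
          refine Int.one_le_abs (sub_ne_zero.2 fun h => hij (Fin.ext ?_))
          exact_mod_cast h
        exact_mod_cast this
      rw [dist_eq_norm, h1, norm_smul, he, mul_one, norm_mul, norm_mul, Real.norm_of_nonneg hρ.le,
        Real.norm_eq_abs, Real.norm_eq_abs, abs_of_pos (by norm_num : (0 : ℝ) < 3)]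
      nlinarith
    · have h1 : Tendsto (fun ρ : ℝ => dist (b ρ i) (b ρ j) - (ρ + ρ)) (𝓝[>] 0)
          (𝓝 (dist (c i) (c j))) := by
        have : Continuous fun ρ : ℝ => dist (b ρ i) (b ρ j) - (ρ + ρ) := by fun_prop
        have h := this.tendsto 0
        simp only [hb0, add_zero, sub_zero] at h
        exact h.mono_left nhdsWithin_le_nhds
      filter_upwards [h1.eventually_const_lt (dist_pos.2 hcij)] with ρ hρ
      linarith
  have hineq : ∀ᶠ ρ in 𝓝[>] (0 : ℝ), 0 ≤ ∑ i, ⟪b ρ (σ i) - b ρ i,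
      ⨍ x in Metric.closedBall (b ρ (σ i)) ρ, B.indicator T x ∂μ⟫ := by
    have hdis' : ∀ᶠ ρ in 𝓝[>] (0 : ℝ), ∀ i j, i ≠ j →
        Disjoint (Metric.closedBall (b ρ i) ρ) (Metric.closedBall (b ρ j) ρ) := by
      simp only [eventually_all]
      exact hdis
    filter_upwards [eventually_all.2 hsub, hdis'] with ρ hρB hρd
    have hd : Pairwise fun i j =>
      Disjoint (Metric.closedBall (b ρ i) ρ) (Metric.closedBall (b ρ j) ρ) := fun i j => hρd i j
    have h := hopt _ (measurePreserving_permuteBalls (σ := σ) μ hd hρB)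
    rw [integral_inner_permuteBalls μ hT hd hρB] at h
    have havg : ∀ i, ⨍ x in Metric.closedBall (b ρ i) ρ, B.indicator T x ∂μ =
        (μ.real (Metric.closedBall 0 ρ))⁻¹ • ∫ x in Metric.closedBall (b ρ i) ρ, T x ∂μ := by
      intro i
      rw [setAverage_eq, setIntegral_indicator hBo.measurableSet,
        Set.inter_eq_left.2 (hρB i), measureReal_def, measureReal_def,
        Measure.addHaar_closedBall_center]
    simp only [havg, inner_smul_right]
    rw [← Finset.mul_sum]
    exact mul_nonneg (by positivity) h
  let δ : ℕ → ℝ := fun j => 1 / ((j : ℝ) + 1)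
  have hδ0 : ∀ j, 0 < δ j := fun j => by positivity
  have hδ : Tendsto δ atTop (𝓝[>] 0) := tendsto_nhdsWithin_iff.2
    ⟨tendsto_one_div_add_atTop_nhds_zero_nat, Eventually.of_forall hδ0⟩
  have hlim : Tendsto (fun j => ∑ i, ⟪b (δ j) (σ i) - b (δ j) i,
      ⨍ x in Metric.closedBall (b (δ j) (σ i)) (δ j), B.indicator T x ∂μ⟫) atTop
      (𝓝 (∑ i : Fin (k + 1), ⟪c (σ i) - c i, T (c (σ i))⟫)) := by
    refine tendsto_finsetSum _ fun i _ => Tendsto.inner ?_ ?_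
    · have hbl : ∀ i, Tendsto (fun j => b (δ j) i) atTop (𝓝 (c i)) := by
        intro i
        have h := ((hbc i).tendsto 0).comp (hδ.mono_right nhdsWithin_le_nhds)
        rwa [hb0] at h
      exact (hbl _).sub (hbl _)
    · exact hleb _ (3 * (k + 1)) _ δ hδ fun j => hbdist _ _ (hδ0 j).le
  have hfin := ge_of_tendsto hlim (hδ.eventually hineq)
  have hre : ∑ i : Fin (k + 1), ⟪c (σ i) - c i, T (c (σ i))⟫ =
      - ∑ i : Fin (k + 1), ⟪c i, T (c (σ i)) - T (c i)⟫ := by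
    have := Equiv.sum_comp σ fun i : Fin (k + 1) => ⟪c i, T (c i)⟫
    simp only [inner_sub_left, inner_sub_right, Finset.sum_sub_distrib]
    rw [this]
    ring
  have hsum : ∑ i : Fin (k + 1), ⟪c i, T (c (σ i)) - T (c i)⟫ =
      ∑ i ∈ Finset.range k, ⟪c i, T (c (i + 1)) - T (c i)⟫ + ⟪c k, T (c 0) - T (c k)⟫ := by
    rw [Fin.sum_univ_castSucc, Finset.sum_range]
    simp [σ, Fin.coeSucc_eq_succ]
  rw [hre, hsum] at hfin
  linarith

end Optimality

section Transport

open scoped RealInnerProductSpace NNReal ENNReal Pointwise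
open Filter Topology

variable {E : Type*} [NormedAddCommGroup E] [InnerProductSpace ℝ E] [FiniteDimensional ℝ E]
  [MeasurableSpace E] [BorelSpace E]

/-- Among measures of density at most one and given mass, the centered ball has the smallest second
moment. -/
theorem setIntegral_ball_norm_sq_le {μ η : Measure E} [IsFiniteMeasureOnCompacts μ]
    [IsFiniteMeasure η] (hle : η ≤ μ) {r : ℝ} (hr : 0 ≤ r)
    (hmass : η.real Set.univ = μ.real (Metric.ball 0 r)) (hint : Integrable (fun y => ‖y‖ ^ 2) η) :
    ∫ y in Metric.ball (0 : E) r, ‖y‖ ^ 2 ∂μ ≤ ∫ y, ‖y‖ ^ 2 ∂η := by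
  set B := Metric.ball (0 : E) r with hB
  have hBm : MeasurableSet B := Metric.isOpen_ball.measurableSet
  have hcont : ∀ f : E → ℝ, Continuous f → IntegrableOn f B μ := fun f hf =>
    (hf.continuousOn.integrableOn_compact (isCompact_closedBall (0 : E) r)).mono_set
      Metric.ball_subset_closedBall
  set g : E → ℝ := B.indicator fun y => r ^ 2 - ‖y‖ ^ 2 with hg
  have hgi : Integrable g μ := (integrable_indicator_iff hBm).2 (hcont _ (by fun_prop))
  have hg0 : ∀ y, 0 ≤ g y := by
    intro y
    refine Set.indicator_nonneg (fun y hy => ?_) y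
    rw [hB, mem_ball_zero_iff] at hy
    nlinarith [norm_nonneg y]
  have hgle : ∀ y, r ^ 2 - ‖y‖ ^ 2 ≤ g y := by
    intro y
    by_cases hy : y ∈ B
    · rw [hg, Set.indicator_of_mem hy]
    · rw [hg, Set.indicator_of_notMem hy]
      rw [hB, mem_ball_zero_iff, not_lt] at hy
      nlinarith
  have h1 : ∫ y, (r ^ 2 - ‖y‖ ^ 2) ∂η ≤ ∫ y, g y ∂η :=
    integral_mono ((integrable_const _).sub hint) (hgi.mono_measure hle) hgle
  have h2 : ∫ y, g y ∂η ≤ ∫ y, g y ∂μ :=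
    integral_mono_measure hle (Eventually.of_forall hg0) hgi
  have h3 : ∫ y, g y ∂μ = μ.real B * r ^ 2 - ∫ y in B, ‖y‖ ^ 2 ∂μ := by
    rw [hg, integral_indicator hBm, integral_sub (hcont _ continuous_const) (hcont _ (by fun_prop)),
      setIntegral_const, smul_eq_mul]
  rw [h3] at h2
  rw [integral_sub (integrable_const _) hint, integral_const, hmass, smul_eq_mul] at h1
  linarith

/-- Expansion of the transport cost in terms of second moments and the correlation. -/
theorem integral_norm_sub_sq_of_map_eq {ν κ : Measure E} {S : E → E} (hS : Measurable S)
    (hmap : ν.map S = κ) (hκ : Integrable (fun y => ‖y‖ ^ 2) κ)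
    (hν : Integrable (fun x => ‖x‖ ^ 2) ν) :
    Integrable (fun x => ‖S x‖ ^ 2) ν ∧ ∫ x, ‖S x‖ ^ 2 ∂ν = ∫ y, ‖y‖ ^ 2 ∂κ ∧
      Integrable (fun x => ⟪x, S x⟫) ν ∧
      ∫ x, ‖S x - x‖ ^ 2 ∂ν = ∫ y, ‖y‖ ^ 2 ∂κ + ∫ x, ‖x‖ ^ 2 ∂ν - 2 * ∫ x, ⟪x, S x⟫ ∂ν := by
  subst hmap
  have h1 : Integrable (fun x => ‖S x‖ ^ 2) ν := hκ.comp_measurable hS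
  have h2 : ∫ x, ‖S x‖ ^ 2 ∂ν = ∫ y, ‖y‖ ^ 2 ∂(ν.map S) :=
    (integral_map (f := fun y : E => ‖y‖ ^ 2) hS.aemeasurable (by fun_prop)).symm
  have h3 : Integrable (fun x => ⟪x, S x⟫) ν := by
    refine (h1.add hν).mono' (by fun_prop) (Eventually.of_forall fun x => ?_)
    rw [Real.norm_eq_abs, Pi.add_apply]
    refine (abs_real_inner_le_norm _ _).trans ?_
    nlinarith [sq_nonneg (‖x‖ - ‖S x‖), sq_nonneg ‖x‖, sq_nonneg ‖S x‖]
  refine ⟨h1, h2, h3, ?_⟩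
  have h4 : Integrable (fun x => ‖S x‖ ^ 2 + ‖x‖ ^ 2) ν := h1.add hν
  rw [← h2, ← integral_add h1 hν, ← integral_const_mul, ← integral_sub h4 (h3.const_mul 2)]
  refine integral_congr_ae (Eventually.of_forall fun x => ?_)
  simp only [norm_sub_sq_real, real_inner_comm]
  ring

/-- Interpolating along a cyclically monotone transport map from a centered ball does not decrease
the second moment below that of the dilated ball. -/
theorem CyclicallyMonotoneOn.setIntegral_norm_add_smul_sq_ge (μ : Measure E) [μ.IsAddHaarMeasure]
    {T : E → E} (hT : Measurable T) {r : ℝ} (hr : 0 ≤ r) {X : Set E}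
    (hX : MeasurableSet X) (hXB : X ⊆ Metric.ball 0 r) (hX0 : μ (Metric.ball 0 r \ X) = 0)
    (hmono : CyclicallyMonotoneOn T X)
    (hpush : (μ.restrict (Metric.ball 0 r)).map T ≤ μ) {s : ℝ} (hs : 0 < s)
    (hint : IntegrableOn (fun x => ‖x + s • T x‖ ^ 2) (Metric.ball 0 r) μ) :
    (1 + s) ^ 2 * ∫ x in Metric.ball 0 r, ‖x‖ ^ 2 ∂μ ≤
      ∫ x in Metric.ball 0 r, ‖x + s • T x‖ ^ 2 ∂μ := by
  set B := Metric.ball (0 : E) r with hB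
  have hq : 0 < 1 + s := by positivity
  have hBX : μ.restrict X = μ.restrict B :=
    Measure.restrict_congr_set (ae_eq_set.2 ⟨by simp [Set.sdiff_eq_empty.2 hXB], hX0⟩)
  have : IsFiniteMeasure (μ.restrict B) :=
    ⟨by rw [Measure.restrict_apply_univ]; exact measure_ball_lt_top⟩
  set Z : E → E := fun x => (1 + s)⁻¹ • (x + s • T x) with hZ
  have hZm : Measurable Z := by fun_prop
  have hYm : Measurable fun x => x + s • T x := by fun_prop
  have hpush' : ∀ A, MeasurableSet A → μ (X ∩ T ⁻¹' A) ≤ μ A := by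
    intro A hA
    refine le_trans ?_ (hpush A)
    rw [Measure.map_apply hT hA, Measure.restrict_apply (hT hA), Set.inter_comm]
    exact measure_mono (Set.inter_subset_inter_right _ hXB)
  have hle : (μ.restrict B).map Z ≤ μ := by
    refine Measure.le_iff.2 fun F hF => ?_
    have hFs : MeasurableSet ((1 + s) • F) := hF.const_smul₀ _
    have hpre : Z ⁻¹' F = (fun x => x + s • T x) ⁻¹' ((1 + s) • F) := by
      ext x
      rw [Set.mem_preimage, Set.mem_preimage, Set.mem_smul_set_iff_inv_smul_mem₀ hq.ne']
    rw [← hBX, Measure.map_apply hZm hF, hpre, Measure.restrict_apply (hYm hFs), Set.inter_comm]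
    refine (hmono.measure_preimage_add_smul_le μ (r := ⟨r, hr⟩) hX (fun x hx => ?_) hT hpush' hs
      hFs).trans_eq ?_
    · exact (mem_ball_zero_iff.1 (hXB hx)).le
    · rw [Measure.addHaar_smul, ← mul_assoc, ← ENNReal.ofReal_mul (by positivity),
        abs_of_pos (by positivity), inv_mul_cancel₀ (by positivity), ENNReal.ofReal_one, one_mul]
  have hnorm : ∀ x, ‖Z x‖ ^ 2 = ((1 + s) ^ 2)⁻¹ * ‖x + s • T x‖ ^ 2 := by
    intro x
    rw [hZ, norm_smul, norm_inv, Real.norm_of_nonneg hq.le, mul_pow, inv_pow]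
  have key := setIntegral_ball_norm_sq_le hle hr ?_ ?_
  · rw [integral_map hZm.aemeasurable (by fun_prop)] at key
    simp only [hnorm] at key
    rw [integral_const_mul] at key
    rwa [← le_inv_mul_iff₀ (by positivity)]
  · rw [measureReal_def, measureReal_def, Measure.map_apply hZm MeasurableSet.univ,
      Set.preimage_univ, Measure.restrict_apply_univ]
  · rw [integrable_map_measure (by fun_prop) hZm.aemeasurable]
    refine (hint.const_mul ((1 + s) ^ 2)⁻¹).congr (Eventually.of_forall fun x => ?_)
    exact (hnorm x).symm

end Transport

/-- If `T` is an optimal (quadratic-cost minimizing) measure-preserving map pushing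
`1_{D*}` forward to `1_D`, where `D* = B(0,r)` is the centered ball with the same
volume as `D`, then `M₂[1_D] − M₂[1_{D*}] ≥ ∫_{D*} |T(x) − x|² dx`. -/
theorem second_moment_ge_transport_cost {n : ℕ}
    (D : Set (EuclideanSpace ℝ (Fin n))) (hD : MeasurableSet D)
    (hDfin : volume D < ⊤)
    (hM2 : IntegrableOn (fun x => ‖x‖ ^ 2) D)
    (r : ℝ) (hr : 0 ≤ r)
    (hvol : volume (Metric.ball (0 : EuclideanSpace ℝ (Fin n)) r) = volume D)
    (T : EuclideanSpace ℝ (Fin n) → EuclideanSpace ℝ (Fin n)) (hTmeas : Measurable T)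
    (hT : Measure.map T (volume.restrict (Metric.ball (0 : EuclideanSpace ℝ (Fin n)) r)) =
      volume.restrict D)
    (hopt : ∀ S : EuclideanSpace ℝ (Fin n) → EuclideanSpace ℝ (Fin n), Measurable S →
      Measure.map S (volume.restrict (Metric.ball (0 : EuclideanSpace ℝ (Fin n)) r)) =
        volume.restrict D →
      ∫ x in Metric.ball (0 : EuclideanSpace ℝ (Fin n)) r, ‖T x - x‖ ^ 2 ≤
        ∫ x in Metric.ball (0 : EuclideanSpace ℝ (Fin n)) r, ‖S x - x‖ ^ 2) :
    (∫ x in D, ‖x‖ ^ 2) -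
        ∫ x in Metric.ball (0 : EuclideanSpace ℝ (Fin n)) r, ‖x‖ ^ 2 ≥
      ∫ x in Metric.ball (0 : EuclideanSpace ℝ (Fin n)) r, ‖T x - x‖ ^ 2 := by
  rcases Nat.eq_zero_or_pos n with rfl | hn
  · simp [Subsingleton.elim _ (0 : EuclideanSpace ℝ (Fin 0))]
  have : Nonempty (Fin n) := ⟨⟨0, hn⟩⟩
  set B := Metric.ball (0 : EuclideanSpace ℝ (Fin n)) r with hB
  have hcont : ∀ f : EuclideanSpace ℝ (Fin n) → ℝ, Continuous f → IntegrableOn f B := fun f hf =>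
    (hf.continuousOn.integrableOn_compact (isCompact_closedBall 0 r)).mono_set
      Metric.ball_subset_closedBall
  have hMB : IntegrableOn (fun x => ‖x‖ ^ 2) B := hcont _ (by fun_prop)
  obtain ⟨hT2, hT2eq, hTi, hTcost⟩ := integral_norm_sub_sq_of_map_eq hTmeas hT hM2 hMB
  have hTint : IntegrableOn T B := by
    refine ((hcont _ (continuous_const (y := (1 : ℝ)))).add hT2).mono' hTmeas.aestronglyMeasurable
      (Filter.Eventually.of_forall fun x => ?_)
    rw [Pi.add_apply]
    nlinarith [sq_nonneg (‖T x‖ - 1), sq_nonneg ‖T x‖]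
  obtain ⟨X, hXB, hXm, hX0, hmono⟩ := exists_cyclicallyMonotoneOn_of_forall_measurePreserving
    volume Metric.isOpen_ball hTint (fun R hR => by
      have hTR : Measurable (T ∘ R) := hTmeas.comp hR.measurable
      have hmap : Measure.map (T ∘ R) (volume.restrict B) = volume.restrict D := by
        rw [← Measure.map_map hTmeas hR.measurable, hR.map_eq, hT]
      obtain ⟨-, -, hSi, hScost⟩ := integral_norm_sub_sq_of_map_eq hTR hmap hM2 hMB
      have h1 := hopt _ hTR hmap
      rw [hTcost, hScost] at h1
      have h2 : ∫ x in B, inner ℝ (R x) (T (R x)) = ∫ x in B, inner ℝ x (T x) := by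
        have h := integral_map (μ := volume.restrict B) (φ := R) hR.measurable.aemeasurable
          (f := fun x => inner ℝ x (T x)) (by fun_prop)
        rw [hR.map_eq] at h
        exact h.symm
      have h3 : Integrable (fun x => inner ℝ (R x) (T (R x))) (volume.restrict B) :=
        hR.integrable_comp_of_integrable hTi
      have h4 : Integrable (fun x => inner ℝ x (T (R x))) (volume.restrict B) := hSi
      have h5 := integral_sub h3 h4
      simp only [inner_sub_left]
      change 0 ≤ ∫ x in B, (inner ℝ (R x) (T (R x)) - inner ℝ x (T (R x)))
      rw [h5, h2]
      simp only [Function.comp_apply] at h1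
      linarith)
  have hpush : Measure.map T (volume.restrict B) ≤ volume := hT ▸ Measure.restrict_le_self
  have hinterp : ∀ s : ℝ, 0 < s → (1 + s) ^ 2 * ∫ x in B, ‖x‖ ^ 2 ≤
      (∫ x in B, ‖x‖ ^ 2) + 2 * s * (∫ x in B, inner ℝ x (T x)) + s ^ 2 * ∫ x in D, ‖x‖ ^ 2 := by
    intro s hs
    have hexp : (fun x => ‖x + s • T x‖ ^ 2) =
        fun x => ‖x‖ ^ 2 + 2 * s * inner ℝ x (T x) + s ^ 2 * ‖T x‖ ^ 2 := by
      funext x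
      rw [norm_add_sq_real, inner_smul_right, norm_smul, mul_pow, Real.norm_eq_abs, sq_abs]
      ring
    have hi1 : Integrable (fun x => ‖x‖ ^ 2 + 2 * s * inner ℝ x (T x)) (volume.restrict B) :=
      hMB.integrable.add (hTi.const_mul (2 * s))
    have hi2 := hT2.const_mul (s ^ 2)
    have h := hmono.setIntegral_norm_add_smul_sq_ge volume hTmeas hr hXm hXB hX0 hpush hs
      (by rw [hexp]; exact hi1.add hi2)
    simp only [hexp] at h
    change (1 + s) ^ 2 * ∫ x in B, ‖x‖ ^ 2 ≤
      ∫ x in B, (‖x‖ ^ 2 + 2 * s * inner ℝ x (T x) + s ^ 2 * ‖T x‖ ^ 2) at h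
    rwa [integral_add hi1 hi2, integral_add hMB.integrable (hTi.const_mul (2 * s)),
      integral_const_mul, integral_const_mul, hT2eq] at h
  have hcorr : ∫ x in B, ‖x‖ ^ 2 ≤ ∫ x in B, inner ℝ x (T x) := by
    refine le_of_forall_pos_le_add fun ε hε => ?_
    set a := ∫ x in D, ‖x‖ ^ 2
    have hpos : 0 < |a| + 1 := by positivity
    have h := hinterp (ε / (|a| + 1)) (by positivity)
    have hMB0 : 0 ≤ ∫ x in B, ‖x‖ ^ 2 := integral_nonneg fun x => by positivity
    set s := ε / (|a| + 1) with hs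
    have hs0 : 0 < s := by positivity
    have hsa : s * a ≤ ε := by
      have : s * (|a| + 1) = ε := div_mul_cancel₀ _ hpos.ne'
      nlinarith [le_abs_self a]
    nlinarith
  rw [hTcost]
  linarith
end

section
/- Let n ≥ 3 and 𝒩 the Newtonian potential in ℝⁿ. Let ρ₁ = 1_{B(0,1)} and a ∈ ℝⁿ with |a| ≥ 3, and write T_a ρ₁ = ρ₁(·+a). Then ℰ_𝒩[T_a ρ₁ − ρ₁] = 2 ∫ (ρ₁ * 𝒩)(ρ₁ − T_a ρ₁) dx ≥ 2‖ρ₁‖₁ (inf_{B(0,1)} (ρ₁*𝒩) − sup_{B(0,2)^c} (ρ₁*𝒩)) > 0. -/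
open MeasureTheory

section
open Metric Module
open scoped RealInnerProductSpace

variable {E : Type*} [NormedAddCommGroup E] [InnerProductSpace ℝ E] [FiniteDimensional ℝ E]
  [MeasurableSpace E] [BorelSpace E]

/-- A power of the norm above the critical exponent is integrable on every ball. -/
lemma integrableOn_norm_rpow_ball [Nontrivial E] {p : ℝ} (hp : -(finrank ℝ E : ℝ) < p) (x : E)
    (r : ℝ) : IntegrableOn (fun w : E => ‖w‖ ^ p) (ball x r) := by
  have hR : 0 < |r| + ‖x‖ + 1 := by positivity
  have hd : 1 ≤ finrank ℝ E := finrank_pos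
  refine IntegrableOn.mono_set (t := ball 0 (|r| + ‖x‖ + 1)) ?_ (ball_subset_ball' ?_)
  · rw [integrableOn_fun_norm_addHaar volume (f := fun t => t ^ p)]
    refine ((intervalIntegral.integrableOn_Ioo_rpow_iff (s := finrank ℝ E - 1 + p) hR).2
      (by linarith)).congr_fun (fun t ht => ?_) measurableSet_Ioo
    have : ((finrank ℝ E - 1 : ℕ) : ℝ) = finrank ℝ E - 1 := by push_cast [hd]; ring
    simp only [smul_eq_mul]
    rw [Real.rpow_add ht.1, ← this, Real.rpow_natCast]
  · rw [dist_zero_right]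
    linarith [le_abs_self r]

/-- The reflection in the perpendicular bisector of `x` and `z`, together with its effect on
norms. -/
lemma exists_measurePreserving_reflection {x z : E} (hxz : x ≠ z) :
    ∃ T : E → E, MeasurePreserving T ∧ MeasurableEmbedding T ∧ (∀ w, dist (T w) z = dist w x) ∧
      (∀ w, dist (T w) x = dist w z) ∧
      ∀ w, (‖T w‖ ^ 2 - ‖w‖ ^ 2) * ‖z - x‖ ^ 2 =
        (dist w z ^ 2 - dist w x ^ 2) * (‖z‖ ^ 2 - ‖x‖ ^ 2) := by
  set L : E ≃ₗᵢ[ℝ] E := (ℝ ∙ (z - x))ᗮ.reflection with hL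
  have hLd : L (z - x) = -(z - x) := Submodule.reflection_orthogonalComplement_singleton_eq_neg _
  have hd : ‖z - x‖ ≠ 0 := norm_ne_zero_iff.2 (sub_ne_zero.2 hxz.symm)
  refine ⟨fun w => L (w - x) + z, ?_, ?_, fun w => ?_, fun w => ?_, fun w => ?_⟩
  · exact ((measurePreserving_add_right volume z).comp L.measurePreserving).comp
      (measurePreserving_sub_right volume x)
  · exact ((MeasurableEquiv.addRight z).measurableEmbedding.comp
      L.toHomeomorph.measurableEmbedding).comp (MeasurableEquiv.subRight x).measurableEmbedding
  · rw [dist_eq_norm, add_sub_cancel_right, L.norm_map, dist_eq_norm]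
  · have : L (w - x) + z - x = L (w - z) := by
      have : w - z = (w - x) - (z - x) := by abel
      rw [this, map_sub L (w - x), hLd]; abel
    rw [dist_eq_norm, this, L.norm_map, dist_eq_norm]
  · have hLw : L (w - x) = (w - x) - (2 * (⟪z - x, w - x⟫ / ‖z - x‖ ^ 2)) • (z - x) := by
      rw [hL, Submodule.reflection_orthogonal_apply, Submodule.reflection_singleton_apply]
      simp [mul_smul, two_smul]
    have hT : L (w - x) + z = w + (1 - 2 * (⟪z - x, w - x⟫ / ‖z - x‖ ^ 2)) • (z - x) := by
      rw [hLw, sub_smul, one_smul]; abel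
    have hwz : dist w z ^ 2 = dist w x ^ 2 - 2 * ⟪z - x, w - x⟫ + ‖z - x‖ ^ 2 := by
      rw [dist_eq_norm, dist_eq_norm, show w - z = (w - x) - (z - x) by abel,
        norm_sub_sq_real, real_inner_comm]
    have hz : ‖z‖ ^ 2 = ‖x‖ ^ 2 + 2 * ⟪z - x, x⟫ + ‖z - x‖ ^ 2 := by
      conv_lhs => rw [show z = x + (z - x) by abel]
      rw [norm_add_sq_real, real_inner_comm]
    have hw : ⟪z - x, w⟫ = ⟪z - x, w - x⟫ + ⟪z - x, x⟫ := by
      rw [← inner_add_right, sub_add_cancel]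
    beta_reduce
    rw [hT, hwz, hz, norm_add_sq_real, inner_smul_right, real_inner_comm _ w, hw, norm_smul, mul_pow,
      Real.norm_eq_abs, sq_abs]
    field_simp
    ring

lemma setIntegral_ball_sub_setIntegral_ball {f : E → ℝ} {x z : E} {r : ℝ}
    (hx : IntegrableOn f (ball x r)) (hz : IntegrableOn f (ball z r)) {T : E → E}
    (hT : MeasurePreserving T) (hTe : MeasurableEmbedding T)
    (hTz : ∀ w, dist (T w) z = dist w x) (hTx : ∀ w, dist (T w) x = dist w z) :
    IntegrableOn (fun w => f w - f (T w)) (ball x r \ ball z r) ∧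
    (∫ w in ball x r, f w) - ∫ w in ball z r, f w =
      ∫ w in ball x r \ ball z r, (f w - f (T w)) := by
  have hpre : T ⁻¹' (ball z r \ ball x r) = ball x r \ ball z r := by
    ext w; simp [hTz, hTx]
  have hi1 : IntegrableOn f (ball x r \ ball z r) := hx.mono_set Set.sdiff_subset
  have hi2 : IntegrableOn (fun w => f (T w)) (ball x r \ ball z r) := by
    rw [← hpre]
    exact (hT.integrableOn_comp_preimage hTe).2 (hz.mono_set Set.sdiff_subset)
  refine ⟨hi1.sub hi2, ?_⟩
  rw [integral_sub hi1 hi2, ← integral_inter_add_sdiff (t := ball z r) measurableSet_ball hx,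
    ← integral_inter_add_sdiff (t := ball x r) measurableSet_ball hz, Set.inter_comm (ball z r),
    ← hT.setIntegral_preimage_emb hTe f (ball z r \ ball x r), hpre]
  ring

/-- Integrals of a negative power of the norm over balls decrease as the centre moves away from
the origin. -/
lemma setIntegral_norm_rpow_ball_anti [Nontrivial E] {p : ℝ} (hp : -(finrank ℝ E : ℝ) < p)
    (hp0 : p < 0) {x z : E} (hxz : ‖x‖ ≤ ‖z‖) (r : ℝ) :
    ∫ w in ball z r, ‖w‖ ^ p ≤ ∫ w in ball x r, ‖w‖ ^ p := by
  rcases eq_or_ne x z with rfl | hne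
  · rfl
  obtain ⟨T, hT, hTe, hTz, hTx, hTn⟩ := exists_measurePreserving_reflection hne
  have key := setIntegral_ball_sub_setIntegral_ball (integrableOn_norm_rpow_ball hp x r)
    (integrableOn_norm_rpow_ball hp z r) hT hTe hTz hTx
  rw [← sub_nonneg, key.2]
  refine integral_nonneg_of_ae ?_
  have h0 : ∀ᵐ w : E, w ≠ 0 := by simp [ae_iff]
  filter_upwards [ae_restrict_of_ae h0,
    ae_restrict_mem (measurableSet_ball.diff measurableSet_ball)] with w hw hwm
  simp only [Set.mem_sdiff, mem_ball, not_lt] at hwm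
  have hd : 0 < ‖z - x‖ ^ 2 := by
    have := sub_ne_zero.2 hne.symm
    positivity
  have h1 : 0 ≤ (‖T w‖ ^ 2 - ‖w‖ ^ 2) * ‖z - x‖ ^ 2 := by
    rw [hTn]
    refine mul_nonneg (sub_nonneg.2 ?_) (sub_nonneg.2 ?_)
    · gcongr; linarith
    · gcongr
  have h2 : ‖w‖ ≤ ‖T w‖ :=
    le_of_sq_le_sq (sub_nonneg.1 (nonneg_of_mul_nonneg_left h1 hd)) (norm_nonneg _)
  exact sub_nonneg.2 (Real.rpow_le_rpow_of_nonpos (norm_pos_iff.2 hw) h2 hp0.le)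

lemma setIntegral_norm_rpow_ball_strictAnti [Nontrivial E] {p : ℝ}
    (hp : -(finrank ℝ E : ℝ) < p) (hp0 : p < 0) {x z : E} (hxz : ‖x‖ < ‖z‖) {r : ℝ} (hr : 0 < r) :
    ∫ w in ball z r, ‖w‖ ^ p < ∫ w in ball x r, ‖w‖ ^ p := by
  have hne : x ≠ z := by rintro rfl; exact hxz.false
  obtain ⟨T, hT, hTe, hTz, hTx, hTn⟩ := exists_measurePreserving_reflection hne
  have key := setIntegral_ball_sub_setIntegral_ball (integrableOn_norm_rpow_ball hp x r)
    (integrableOn_norm_rpow_ball hp z r) hT hTe hTz hTx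
  rw [← sub_pos, key.2]
  have h0 : ∀ᵐ w : E, w ≠ 0 := by simp [ae_iff]
  have hd : 0 < ‖z - x‖ := norm_pos_iff.2 (sub_ne_zero.2 hne.symm)
  have hpos : ∀ w ∈ ball x r \ ball z r, w ≠ 0 → 0 < ‖w‖ ^ p - ‖T w‖ ^ p := by
    intro w hwm hw
    simp only [Set.mem_sdiff, mem_ball, not_lt] at hwm
    have h1 : 0 < (‖T w‖ ^ 2 - ‖w‖ ^ 2) * ‖z - x‖ ^ 2 := by
      rw [hTn]
      refine mul_pos (sub_pos.2 ?_) (sub_pos.2 ?_)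
      · gcongr; linarith
      · gcongr
    have h2 : ‖w‖ < ‖T w‖ :=
      lt_of_pow_lt_pow_left₀ 2 (norm_nonneg _)
        (sub_pos.1 (pos_of_mul_pos_left h1 (sq_nonneg _)))
    exact sub_pos.2 (Real.rpow_lt_rpow_of_neg (norm_pos_iff.2 hw) h2 hp0)
  set δ := min ‖z - x‖ r / 2 with hδ
  have hδ0 : 0 < δ := by positivity
  have hδd : 2 * δ ≤ ‖z - x‖ := by rw [hδ]; linarith [min_le_left ‖z - x‖ r]
  have hδr : 2 * δ ≤ r := by rw [hδ]; linarith [min_le_right ‖z - x‖ r]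
  set q := x - ((r - δ) / ‖z - x‖) • (z - x) with hq
  have hqx : dist q x = r - δ := by
    rw [dist_eq_norm, hq, sub_sub_cancel_left, norm_neg, norm_smul, Real.norm_eq_abs,
      abs_of_nonneg (div_nonneg (by linarith) hd.le), div_mul_cancel₀ _ hd.ne']
  have hqz : dist q z = ‖z - x‖ + (r - δ) := by
    have : q - z = -((1 + (r - δ) / ‖z - x‖) • (z - x)) := by
      rw [hq, add_smul, one_smul]; abel
    rw [dist_eq_norm, this, norm_neg, norm_smul, Real.norm_eq_abs, abs_of_nonneg
      (add_nonneg zero_le_one (div_nonneg (by linarith) hd.le)), add_mul,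
      div_mul_cancel₀ _ hd.ne', one_mul]
  have hsub : ball q δ ⊆ ball x r \ ball z r := by
    intro w hw
    rw [mem_ball] at hw
    simp only [Set.mem_sdiff, mem_ball, not_lt]
    have h1 := dist_triangle w q x
    have h2 := dist_triangle q w z
    rw [dist_comm q w] at h2
    constructor <;> linarith
  rw [setIntegral_pos_iff_support_of_nonneg_ae _ key.1]
  · refine (measure_ball_pos volume q hδ0).trans_le ?_
    rw [← measure_inter_add_sdiff (ball q δ) (measurableSet_singleton (0 : E)),
      measure_mono_null Set.inter_subset_right (measure_singleton _), zero_add]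
    refine measure_mono fun w hw => ⟨?_, hsub hw.1⟩
    exact (hpos w (hsub hw.1) hw.2).ne'
  · filter_upwards [ae_restrict_of_ae h0,
      ae_restrict_mem (measurableSet_ball.diff measurableSet_ball)] with w hw hwm
    exact (hpos w hwm hw).le

lemma setIntegral_ball_zero_comp_sub (f : E → ℝ) (x : E) (r : ℝ) :
    ∫ y in ball 0 r, f (x - y) = ∫ w in ball x r, f w := by
  have hpre : (fun y => x - y) ⁻¹' ball x r = ball 0 r := by
    ext y; simp [dist_eq_norm]
  rw [← hpre]
  exact (Measure.measurePreserving_sub_left volume x).setIntegral_preimage_emb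
    (MeasurableEquiv.subLeft x).measurableEmbedding f _


/-- The interaction energy of `T_a ρ - ρ` for an even density `ρ` with even potential `u`. -/
lemma integral_integral_translate_sub_mul {ρ N u : E → ℝ} (a : E)
    (hu : ∀ x, u x = ∫ y, ρ y * N (x - y)) (hN : ∀ x, Integrable fun y => ρ y * N (x - y))
    (hρ : ∀ x, ρ (-x) = ρ x) (hu_even : ∀ x, u (-x) = u x)
    (h1 : Integrable fun x => u x * ρ x) (h2 : Integrable fun x => u x * ρ (x + a)) :
    (∫ x, ∫ y, (ρ (x + a) - ρ x) * (ρ (y + a) - ρ y) * N (x - y)) =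
      2 * ∫ x, u x * (ρ x - ρ (x + a)) := by
  have hNa : ∀ x, Integrable fun y => ρ (y + a) * N (x - y) := fun x => by
    simpa using (hN (x + a)).comp_add_right a
  have hua : ∀ x, ∫ y, ρ (y + a) * N (x - y) = u (x + a) := fun x => by
    rw [hu, ← integral_add_right_eq_self (fun y => ρ y * N (x + a - y)) a]
    simp only [add_sub_add_right_eq_sub]
  have hinner : ∀ x, ∫ y, (ρ (x + a) - ρ x) * (ρ (y + a) - ρ y) * N (x - y) =
      (ρ (x + a) - ρ x) * (u (x + a) - u x) := fun x => by
    rw [← hua, hu x, ← integral_sub (hNa x) (hN x), ← integral_const_mul]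
    congr 1 with y
    ring
  have hrefl : ∀ x, u (-(x + a) + a) * ρ (-(x + a)) = u x * ρ (x + a) := fun x => by
    rw [hρ, ← hu_even x]
    congr 2
    abel
  have hrefl' : (fun x => u x * ρ (x + a)) = fun x => (fun y => u (-y + a) * ρ (-y)) (x + a) :=
    funext fun x => (hrefl x).symm
  have h3 : Integrable fun x => u (x + a) * ρ x := by
    rw [hrefl'] at h2
    simpa using ((h2.comp_add_right (-a)).comp_neg)
  have h3' : ∫ x, u (x + a) * ρ x = ∫ x, u x * ρ (x + a) := by
    rw [hrefl', integral_add_right_eq_self (fun y => u (-y + a) * ρ (-y)),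
      ← integral_neg_eq_self]
  have h4 : Integrable fun x => u (x + a) * ρ (x + a) := h1.comp_add_right a
  have h4' : ∫ x, u (x + a) * ρ (x + a) = ∫ x, u x * ρ x :=
    integral_add_right_eq_self (fun x => u x * ρ x) a
  simp only [hinner]
  have hexp : ∀ x, (ρ (x + a) - ρ x) * (u (x + a) - u x) =
      (u (x + a) * ρ (x + a) + u x * ρ x) - (u x * ρ (x + a) + u (x + a) * ρ x) := fun x => by ring
  have h41 : Integrable fun x => u (x + a) * ρ (x + a) + u x * ρ x := h4.add h1
  have h23 : Integrable fun x => u x * ρ (x + a) + u (x + a) * ρ x := h2.add h3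
  simp only [hexp, mul_sub]
  rw [integral_sub h41 h23, integral_add h4 h1, integral_add h2 h3, h3', h4',
    integral_sub h1 h2]
  ring

end

/-- For `n ≥ 3`, `ρ₁ = 1_{B(0,1)}` and `|a| ≥ 3`:
`ℰ_𝒩[T_a ρ₁ − ρ₁] = 2 ∫ (ρ₁ * 𝒩)(ρ₁ − T_a ρ₁) dx
  ≥ 2‖ρ₁‖₁ (inf_{B(0,1)} (ρ₁*𝒩) − sup_{B(0,2)ᶜ} (ρ₁*𝒩)) > 0`. -/
theorem newtonian_energy_translate_lower_bound {n : ℕ} (hn : 3 ≤ n)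
    (a : EuclideanSpace ℝ (Fin n)) (ha : 3 ≤ ‖a‖)
    (N ρ₁ u : EuclideanSpace ℝ (Fin n) → ℝ)
    (hN : ∀ x, N x = 1 / ((n : ℝ) * ((n : ℝ) - 2) *
        (volume (Metric.ball (0 : EuclideanSpace ℝ (Fin n)) 1)).toReal) *
        ‖x‖ ^ ((2 : ℝ) - n))
    (hρ₁ : ρ₁ = (Metric.ball (0 : EuclideanSpace ℝ (Fin n)) 1).indicator fun _ => (1:ℝ))
    (hu : ∀ x, u x = ∫ y in Metric.ball (0 : EuclideanSpace ℝ (Fin n)) 1, N (x - y)) :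
    (∫ x, ∫ y, (ρ₁ (x + a) - ρ₁ x) * (ρ₁ (y + a) - ρ₁ y) * N (x - y)) =
      2 * ∫ x, u x * (ρ₁ x - ρ₁ (x + a)) ∧
    2 * (∫ x, u x * (ρ₁ x - ρ₁ (x + a))) ≥
      2 * (volume (Metric.ball (0 : EuclideanSpace ℝ (Fin n)) 1)).toReal *
        (sInf (u '' Metric.ball (0 : EuclideanSpace ℝ (Fin n)) 1) -
          sSup (u '' (Metric.ball (0 : EuclideanSpace ℝ (Fin n)) 2)ᶜ)) ∧
    0 < 2 * (volume (Metric.ball (0 : EuclideanSpace ℝ (Fin n)) 1)).toReal *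
        (sInf (u '' Metric.ball (0 : EuclideanSpace ℝ (Fin n)) 1) -
          sSup (u '' (Metric.ball (0 : EuclideanSpace ℝ (Fin n)) 2)ᶜ)) := by
  have : NeZero n := ⟨by omega⟩
  have hn' : (3 : ℝ) ≤ n := by exact_mod_cast hn
  set V := (volume (Metric.ball (0 : EuclideanSpace ℝ (Fin n)) 1)).toReal with hV
  have hV0 : 0 < V := ENNReal.toReal_pos (Metric.measure_ball_pos _ _ one_pos).ne'
    measure_ball_lt_top.ne
  set c := 1 / ((n : ℝ) * ((n : ℝ) - 2) * V) with hc
  have hc0 : 0 < c := by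
    have : 0 < (n : ℝ) - 2 := by linarith
    positivity
  have hp0 : (2 : ℝ) - n < 0 := by linarith
  have hp : -(Module.finrank ℝ (EuclideanSpace ℝ (Fin n)) : ℝ) < 2 - n := by
    rw [finrank_euclideanSpace_fin]; linarith
  have hN_eq : N = fun x => c * ‖x‖ ^ ((2 : ℝ) - n) := funext hN
  have hu' : ∀ x, u x = c * ∫ w in Metric.ball x 1, ‖w‖ ^ ((2 : ℝ) - n) := fun x => by
    rw [hu, setIntegral_ball_zero_comp_sub, hN_eq, integral_const_mul]
  have hanti : ∀ {x z}, ‖x‖ ≤ ‖z‖ → u z ≤ u x := fun h => by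
    rw [hu', hu']
    exact mul_le_mul_of_nonneg_left (setIntegral_norm_rpow_ball_anti hp hp0 h 1) hc0.le
  have hstrict : ∀ {x z}, ‖x‖ < ‖z‖ → u z < u x := fun h => by
    rw [hu', hu']
    exact mul_lt_mul_of_pos_left (setIntegral_norm_rpow_ball_strictAnti hp hp0 h one_pos) hc0
  have hu_nonneg : ∀ x, 0 ≤ u x := fun x => by
    rw [hu']
    exact mul_nonneg hc0.le (integral_nonneg fun w => by positivity)
  have hN_meas : Measurable N := by rw [hN_eq]; fun_prop
  have hu_meas : StronglyMeasurable u := by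
    rw [funext hu]
    refine StronglyMeasurable.integral_prod_right (f := fun x y => N (x - y)) ?_
    exact (hN_meas.comp (measurable_fst.sub measurable_snd)).stronglyMeasurable
  have hball : ∀ (x : EuclideanSpace ℝ (Fin n)), volume (Metric.ball x 1) < ⊤ :=
    fun x => measure_ball_lt_top
  have hu_int : ∀ x : EuclideanSpace ℝ (Fin n), IntegrableOn u (Metric.ball x 1) := fun x =>
    Measure.integrableOn_of_bounded (hball x).ne hu_meas.aestronglyMeasurable (M := u 0)
      (.of_forall fun w => by
        rw [Real.norm_of_nonneg (hu_nonneg w)]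
        exact hanti (by simp))
  have hρ_mul : ∀ (f : EuclideanSpace ℝ (Fin n) → ℝ),
      (fun x => f x * ρ₁ x) = (Metric.ball 0 1).indicator f := fun f => by
    classical ext x; rw [hρ₁]; simp [Set.indicator_apply]
  have hρa_mul : ∀ (f : EuclideanSpace ℝ (Fin n) → ℝ),
      (fun x => f x * ρ₁ (x + a)) = (Metric.ball (-a) 1).indicator f := fun f => by
    classical ext x; rw [hρ₁]; simp [Set.indicator_apply, dist_eq_norm]
  have h1 : Integrable fun x => u x * ρ₁ x := by
    rw [hρ_mul, integrable_indicator_iff measurableSet_ball]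
    exact hu_int 0
  have h2 : Integrable fun x => u x * ρ₁ (x + a) := by
    rw [hρa_mul, integrable_indicator_iff measurableSet_ball]
    exact hu_int (-a)
  obtain ⟨e, he⟩ : ∃ e : EuclideanSpace ℝ (Fin n), ‖e‖ = 1 := exists_norm_eq _ zero_le_one
  have he2 : ‖(2 : ℝ) • e‖ = 2 := by rw [norm_smul, he]; norm_num
  have hbdd : BddBelow (u '' Metric.ball 0 1) := ⟨0, by rintro _ ⟨x, -, rfl⟩; exact hu_nonneg x⟩
  have hbdd' : BddAbove (u '' (Metric.ball 0 2)ᶜ) :=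
    ⟨u 0, by rintro _ ⟨x, -, rfl⟩; exact hanti (by simp)⟩
  have hinf : u e ≤ sInf (u '' Metric.ball 0 1) := by
    refine le_csInf ((Metric.nonempty_ball.2 one_pos).image u) ?_
    rintro _ ⟨x, hx, rfl⟩
    exact hanti (by rw [he]; exact (mem_ball_zero_iff.1 hx).le)
  have hsup : sSup (u '' (Metric.ball 0 2)ᶜ) ≤ u ((2 : ℝ) • e) := by
    refine csSup_le (Set.Nonempty.image u ⟨(2 : ℝ) • e, by simp [he2]⟩) ?_
    rintro _ ⟨x, hx, rfl⟩
    exact hanti (by rw [he2]; simpa using hx)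
  refine ⟨?_, ?_, ?_⟩
  · refine integral_integral_translate_sub_mul a (fun x => ?_) (fun x => ?_) (fun x => ?_)
      (fun x => ?_) h1 h2
    · simp only [mul_comm (ρ₁ _)]
      rw [hρ_mul fun y => N (x - y), integral_indicator measurableSet_ball, hu]
    · simp only [mul_comm (ρ₁ _)]
      rw [hρ_mul fun y => N (x - y), integrable_indicator_iff measurableSet_ball]
      have hpre : (fun y => x - y) ⁻¹' Metric.ball x 1 = Metric.ball 0 1 := by
        ext y; simp [dist_eq_norm]
      rw [← hpre]
      refine ((Measure.measurePreserving_sub_left volume x).integrableOn_comp_preimage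
        (MeasurableEquiv.subLeft x).measurableEmbedding).2 ?_
      rw [hN_eq]
      exact (integrableOn_norm_rpow_ball hp x 1).const_mul c
    · classical simp only [hρ₁, Set.indicator_apply, mem_ball_zero_iff, norm_neg]
    · exact le_antisymm (hanti (norm_neg x).ge) (hanti (norm_neg x).le)
  · have hlow : V * sInf (u '' Metric.ball 0 1) ≤ ∫ x in Metric.ball 0 1, u x := by
      have := setIntegral_mono_on (integrableOn_const (C := sInf (u '' Metric.ball 0 1))
        (hball 0).ne) (hu_int 0) measurableSet_ball
        fun x hx => csInf_le hbdd (Set.mem_image_of_mem u hx)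
      simpa [Measure.real] using this
    have hvol : volume (Metric.ball (-a) 1) =
        volume (Metric.ball (0 : EuclideanSpace ℝ (Fin n)) 1) :=
      Measure.addHaar_ball_center _ _ _
    have hupp : ∫ x in Metric.ball (-a) 1, u x ≤ V * sSup (u '' (Metric.ball 0 2)ᶜ) := by
      have := setIntegral_mono_on (hu_int (-a)) (integrableOn_const
        (C := sSup (u '' (Metric.ball 0 2)ᶜ)) (hball (-a)).ne) measurableSet_ball
        fun x hx => le_csSup hbdd' (Set.mem_image_of_mem u (by
          have h3 : ‖a‖ ≤ ‖x + a‖ + ‖x‖ := by simpa using norm_sub_le (x + a) x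
          rw [Metric.mem_ball, dist_eq_norm, sub_neg_eq_add] at hx
          simp only [Set.mem_compl_iff, mem_ball_zero_iff, not_lt]
          linarith))
      simpa [Measure.real, hvol] using this
    simp only [mul_sub]
    rw [integral_sub h1 h2, hρ_mul, hρa_mul, integral_indicator measurableSet_ball,
      integral_indicator measurableSet_ball]
    linarith
  · have := hstrict (x := e) (z := (2 : ℝ) • e) (by rw [he, he2]; norm_num)
    exact mul_pos (by positivity) (by linarith)
end
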